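/- arXiv:1706.08022 — 3 statements merged into one kernel-verified Lean document; each statement's English description precedes it below -/
import Mathlib

section
/- Let Φ : ℂ → ℂ be entire of exponential type, and suppose {z : |Φ(z)| = 1} contains a non-trivial strictly convex compact arc Γ₁ with conv(Γ₁ ∪ {0}) \ (Γ₁ ∪ {0}) ⊆ {z : |Φ(z)| < 1}. Then for each integer m ≥ 1 there exist r > 1, a non-trivial strictly convex compact arc Γ ⊆ {z : |Φ(z)| = r} ∩ {t·z : t ∈ (0,∞), z ∈ Γ₁}, and ε > 0, such that: (i) conv(Γ ∪ {0}) \ Γ ⊆ {z : |Φ(z)| < r}; and (ii) for each j with 1 ≤ j < m, both the j-fold Minkowski sum Σ_{k=1}^j (1/m)Γ := {(w₁ + ⋯ + w_j)/m : w₁, …, w_j ∈ Γ} and the set Λ + Σ_{k=1}^j (1/m)Γ are contained in Ω, where Ω := conv(Γ₁ ∪ {0}) \ (Γ₁ ∪ {0}) and Λ := Ω ∩ {z : |z| < ε} ∩ conv(Γ ∪ {0}). -/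
open Set

noncomputable section

def ExpType (a : ℕ → ℂ) : Prop :=
  ∃ M > (0:ℝ), ∃ R > (0:ℝ), ∀ n : ℕ, ‖a n‖ ≤ M * R ^ n / n.factorial

def IsCompactArc (Γ : Set ℂ) : Prop :=
  ∃ γ : ℝ → ℂ, ContinuousOn γ (Icc 0 1) ∧ InjOn γ (Icc 0 1) ∧ Γ = γ '' Icc 0 1

def StrictlyConvexArc (Γ : Set ℂ) : Prop :=
  IsCompactArc Γ ∧
  ∀ z₁ ∈ Γ, ∀ z₂ ∈ Γ, ∀ u ∈ segment ℝ z₁ z₂ ∩ Γ, ∀ v ∈ segment ℝ z₁ z₂ ∩ Γ,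
    ∀ w ∈ segment ℝ z₁ z₂ ∩ Γ, u = v ∨ u = w ∨ v = w

/-- The region `Ω = conv(Γ₁ ∪ {0}) \ (Γ₁ ∪ {0})`. -/
def OmegaSet (Γ : Set ℂ) : Set ℂ := convexHull ℝ (Γ ∪ {0}) \ (Γ ∪ {0})

open Filter Topology

/-- A holomorphic function whose level curves of the real part bend strictly towards the
sublevel sets has strictly quasiconvex real part. -/
theorem re_lt_max_of_mem_openSegment {F : ℂ → ℂ} {B : Set ℂ} (hB : IsOpen B)
    (hconv : Convex ℝ B) (hF : DifferentiableOn ℂ F B) (hF' : ∀ z ∈ B, deriv F z ≠ 0)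
    (hcurv : ∀ z ∈ B, (deriv (deriv F) z / deriv F z ^ 2).re < 0) {p q x : ℂ}
    (hp : p ∈ B) (hq : q ∈ B) (hpq : p ≠ q) (hx : x ∈ openSegment ℝ p q) :
    (F x).re < max (F p).re (F q).re := by
  have hd0 : q - p ≠ 0 := sub_ne_zero.2 hpq.symm
  set L : ℝ → ℂ := fun t => p + t * (q - p) with hL
  have hLB : ∀ t ∈ Icc (0:ℝ) 1, L t ∈ B := by
    intro t ht
    have := hconv hp hq (sub_nonneg.2 ht.2) ht.1 (by ring)
    convert this using 1
    simp [hL]; ring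
  have hLd : ∀ t, HasDerivAt L (q - p) t := fun t => by
    simpa [hL] using ((Complex.ofRealCLM.hasDerivAt (x := t)).mul_const (q - p)).const_add p
  have hdiff : ∀ z ∈ B, HasDerivAt F (deriv F z) z := fun z hz =>
    (hF.differentiableAt (hB.mem_nhds hz)).hasDerivAt
  have hdiff2 : ∀ z ∈ B, HasDerivAt (deriv F) (deriv (deriv F) z) z := fun z hz =>
    ((hF.deriv hB).differentiableAt (hB.mem_nhds hz)).hasDerivAt
  have re_deriv : ∀ (f : ℝ → ℂ) (f' : ℂ) (t : ℝ), HasDerivAt f f' t →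
      HasDerivAt (fun t => (f t).re) f'.re t := fun f f' t h => by
    exact Complex.reCLM.hasFDerivAt.comp_hasDerivAt t h
  set φ : ℝ → ℝ := fun t => (F (L t)).re with hφ
  have hφd : ∀ t, L t ∈ B → HasDerivAt φ (deriv F (L t) * (q - p)).re t := fun t ht =>
    re_deriv _ _ _ ((hdiff _ ht).comp_of_eq t (hLd t) rfl)
  have hφd2 : ∀ t, L t ∈ B →
      HasDerivAt (deriv φ) (deriv (deriv F) (L t) * (q - p) * (q - p)).re t := fun t ht => by
    have h1 : HasDerivAt (fun t => (deriv F (L t) * (q - p)).re)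
        (deriv (deriv F) (L t) * (q - p) * (q - p)).re t :=
      re_deriv _ _ _ (((hdiff2 _ ht).comp_of_eq t (hLd t) rfl).mul_const _)
    refine h1.congr_of_eventuallyEq ?_
    filter_upwards [(hLd t).continuousAt.preimage_mem_nhds (hB.mem_nhds ht)] with s hs
    exact (hφd s hs).deriv
  have hφc : ContinuousOn φ (Icc 0 1) := fun t ht =>
    (hφd t (hLB t ht)).continuousAt.continuousWithinAt
  -- an interior maximum is impossible
  have hmax : ∀ t ∈ Ioo (0:ℝ) 1, ¬ IsMaxOn φ (Icc 0 1) t := by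
    intro t ht hm
    have hloc : IsLocalMax φ t := hm.isLocalMax (Icc_mem_nhds ht.1 ht.2)
    have htB := hLB t (Ioo_subset_Icc_self ht)
    have hd1 := hloc.deriv_eq_zero
    have hne := hF' _ htB
    have hpos : 0 < deriv (deriv φ) t := by
      rw [(hφd2 t htB).deriv]
      rw [(hφd t htB).deriv] at hd1
      set w := deriv F (L t) * (q - p) with hw
      have hwim : w = w.im * Complex.I := by
        apply Complex.ext <;> simp [hd1]
      have hw0 : w.im ≠ 0 := by
        intro h0
        rw [h0] at hwim
        simp only [Complex.ofReal_zero, zero_mul] at hwim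
        exact mul_ne_zero hne hd0 (hw ▸ hwim)
      have heq : deriv (deriv F) (L t) * (q - p) * (q - p)
          = ((-(w.im ^ 2) : ℝ) : ℂ) * (deriv (deriv F) (L t) / deriv F (L t) ^ 2) := by
        have h2 : ((-(w.im ^ 2) : ℝ) : ℂ) = w ^ 2 := by
          rw [hwim]; simp [mul_pow]
        rw [h2, hw]; field_simp
      rw [heq, Complex.re_ofReal_mul]
      have := hcurv _ htB
      nlinarith [sq_pos_of_ne_zero hw0]
    have hmin := isLocalMin_of_deriv_deriv_pos hpos hd1 (hφd t htB).continuousAt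
    have hconst : φ =ᶠ[𝓝 t] fun _ => φ t := by
      filter_upwards [hloc, hmin] with s h1 h2 using le_antisymm h1 h2
    have := hconst.deriv.deriv_eq
    simp at this
    exact hpos.ne' this
  obtain ⟨t, ht, htm⟩ := isCompact_Icc.exists_isMaxOn (nonempty_Icc.2 zero_le_one) hφc
  obtain ⟨a, b, ha, hb, hab, rfl⟩ := hx
  have hb1 : b ∈ Ioo (0:ℝ) 1 := ⟨hb, by linarith⟩
  have hLb : a • p + b • q = L b := by
    have : (a:ℂ) = 1 - b := by rw [← Complex.ofReal_one, ← hab]; simp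
    simp [hL, this]; ring
  rw [hLb]
  by_contra! hcon
  have h0 : φ 0 ≤ φ b := by simpa [hφ, hL] using le_trans (le_max_left _ _) hcon
  have h1 : φ 1 ≤ φ b := by simpa [hφ, hL] using le_trans (le_max_right _ _) hcon
  rcases eq_or_ne t 0 with rfl | ht0
  · exact hmax b hb1 fun s hs => (htm hs).trans h0
  rcases eq_or_ne t 1 with rfl | ht1
  · exact hmax b hb1 fun s hs => (htm hs).trans h1
  exact hmax t ⟨lt_of_le_of_ne ht.1 ht0.symm, lt_of_le_of_ne ht.2 ht1⟩ htm

/-- A local branch of `log Φ`, up to an additive imaginary constant, that is a biholomorphic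
chart. -/
structure IsLocalLog (Φ : ℂ → ℂ) (e : OpenPartialHomeomorph ℂ ℂ) : Prop where
  differentiableOn : DifferentiableOn ℂ e e.source
  deriv_ne_zero : ∀ z ∈ e.source, deriv e z ≠ 0
  norm_eq : ∀ z ∈ e.source, ‖Φ z‖ = Real.exp (e z).re

theorem IsLocalLog.restrOpen {Φ : ℂ → ℂ} {e : OpenPartialHomeomorph ℂ ℂ} (h : IsLocalLog Φ e)
    (s : Set ℂ) (hs : IsOpen s) : IsLocalLog Φ (e.restrOpen s hs) where
  differentiableOn := h.differentiableOn.mono fun _ hz => hz.1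
  deriv_ne_zero z hz := h.deriv_ne_zero z hz.1
  norm_eq z hz := h.norm_eq z hz.1

theorem IsLocalLog.hasDerivAt {Φ : ℂ → ℂ} {e : OpenPartialHomeomorph ℂ ℂ} (h : IsLocalLog Φ e)
    {z : ℂ} (hz : z ∈ e.source) : HasDerivAt e (deriv e z) z :=
  (h.differentiableOn.differentiableAt (e.open_source.mem_nhds hz)).hasDerivAt

theorem IsLocalLog.hasDerivAt_deriv {Φ : ℂ → ℂ} {e : OpenPartialHomeomorph ℂ ℂ}
    (h : IsLocalLog Φ e) {z : ℂ} (hz : z ∈ e.source) :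
    HasDerivAt (deriv e) (deriv (deriv e) z) z :=
  ((h.differentiableOn.deriv e.open_source).differentiableAt
    (e.open_source.mem_nhds hz)).hasDerivAt

theorem IsLocalLog.continuousAt_curvature {Φ : ℂ → ℂ} {e : OpenPartialHomeomorph ℂ ℂ}
    (h : IsLocalLog Φ e) {z : ℂ} (hz : z ∈ e.source) :
    ContinuousAt (fun z => (deriv (deriv e) z / deriv e z ^ 2).re) z := by
  have h2 : ContinuousAt (deriv (deriv e)) z :=
    (((h.differentiableOn.deriv e.open_source).deriv e.open_source).differentiableAt
      (e.open_source.mem_nhds hz)).continuousAt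
  exact Complex.continuous_re.continuousAt.comp
    (h2.div ((h.hasDerivAt_deriv hz).continuousAt.pow 2) (pow_ne_zero 2 (h.deriv_ne_zero z hz)))

theorem exists_isLocalLog {Φ : ℂ → ℂ} (hΦ : Differentiable ℂ Φ) {z₁ : ℂ} (h1 : ‖Φ z₁‖ = 1)
    (hd : deriv Φ z₁ ≠ 0) :
    ∃ e : OpenPartialHomeomorph ℂ ℂ, z₁ ∈ e.source ∧ IsLocalLog Φ e := by
  have hΦ0 : Φ z₁ ≠ 0 := by
    intro h; simp [h] at h1
  set F : ℂ → ℂ := fun z => Complex.log (Φ z / Φ z₁) with hF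
  set U : Set ℂ := (fun z => Φ z / Φ z₁) ⁻¹' Complex.slitPlane with hU
  have hc : Continuous fun z => Φ z / Φ z₁ := hΦ.continuous.div_const _
  have hUo : IsOpen U := Complex.isOpen_slitPlane.preimage hc
  have hFd : DifferentiableOn ℂ F U := fun z hz =>
    (((hΦ z).div_const _).clog hz).differentiableWithinAt
  have hz1U : z₁ ∈ U := by simp [hU, hΦ0]
  have hder : ∀ z ∈ U, deriv F z = deriv Φ z / Φ z := by
    intro z hz
    have := (((hΦ z).hasDerivAt.div_const (Φ z₁)).clog hz).deriv
    rw [hF, this]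
    field_simp
  have hne1 : deriv F z₁ ≠ 0 := by
    rw [hder z₁ hz1U]; exact div_ne_zero hd hΦ0
  have hstrict : HasStrictDerivAt F (deriv F z₁) z₁ :=
    ((hFd.analyticAt (hUo.mem_nhds hz1U)).hasStrictDerivAt)
  have hs' := hstrict.hasStrictFDerivAt_equiv hne1
  set e₀ := hs'.toOpenPartialHomeomorph F with he₀
  have hcoe : (e₀ : ℂ → ℂ) = F := hs'.toOpenPartialHomeomorph_coe
  have hmem : z₁ ∈ e₀.source := hs'.mem_toOpenPartialHomeomorph_source
  have hderivo : IsOpen {z | deriv Φ z ≠ 0} :=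
    isOpen_ne.preimage (hΦ.contDiff.continuous_deriv le_top)
  refine ⟨e₀.restrOpen (U ∩ {z | deriv Φ z ≠ 0}) (hUo.inter hderivo), ⟨hmem, hz1U, hd⟩, ?_⟩
  have hnz : ∀ z ∈ U, Φ z ≠ 0 := by
    intro z hz h
    simp [hU, h] at hz
  have hcoe' : ∀ s hs, (e₀.restrOpen s hs : ℂ → ℂ) = F := fun s hs => hcoe
  refine ⟨?_, ?_, ?_⟩
  · rw [hcoe']
    exact hFd.mono fun z hz => hz.2.1
  · rintro z ⟨-, hz, hz'⟩
    rw [hcoe', hder z hz]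
    exact div_ne_zero hz' (hnz z hz)
  · rintro z ⟨-, hz, -⟩
    rw [hcoe', hF]
    simp only
    rw [Complex.log_re, norm_div, h1, div_one, Real.exp_log (norm_pos_iff.2 (hnz z hz))]

/-- A strictly convex arc contains no three collinear points. -/
theorem StrictlyConvexArc.eq_of_collinear {Γ : Set ℂ} (h : StrictlyConvexArc Γ) (c d : ℂ)
    {x y z : ℝ} (hx : c + x * d ∈ Γ) (hy : c + y * d ∈ Γ) (hz : c + z * d ∈ Γ) :
    c + x * d = c + y * d ∨ c + x * d = c + z * d ∨ c + y * d = c + z * d := by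
  have key : ∀ x y z : ℝ, x ≤ y → y ≤ z → c + x * d ∈ Γ → c + y * d ∈ Γ → c + z * d ∈ Γ →
      c + x * d = c + y * d ∨ c + x * d = c + z * d ∨ c + y * d = c + z * d := by
    intro x y z hxy hyz hx hy hz
    refine h.2 _ hx _ hz _ ⟨left_mem_segment ℝ _ _, hx⟩ _ ⟨?_, hy⟩ _ ⟨right_mem_segment ℝ _ _, hz⟩
    have hyseg : y ∈ segment ℝ x z := by
      rw [segment_eq_Icc (hxy.trans hyz)]; exact ⟨hxy, hyz⟩
    obtain ⟨a, b, ha, hb, hab, rfl⟩ := hyseg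
    refine ⟨a, b, ha, hb, hab, ?_⟩
    have : (a : ℂ) + b = 1 := by exact_mod_cast hab
    simp only [Complex.real_smul, smul_eq_mul, Complex.ofReal_add, Complex.ofReal_mul]
    linear_combination c * this
  rcases le_total x y with h1 | h1 <;> rcases le_total y z with h2 | h2 <;>
    rcases le_total x z with h3 | h3
  · exact key _ _ _ h1 h2 hx hy hz
  · exact key _ _ _ h1 h2 hx hy hz
  · have := key _ _ _ h3 h2 hx hz hy; grind
  · have := key _ _ _ h3 h1 hz hx hy; grind
  · have := key _ _ _ h1 h3 hy hx hz; grind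
  · have := key _ _ _ h2 h3 hy hz hx; grind
  · have := key _ _ _ h2 h1 hz hy hx; grind
  · have := key _ _ _ h2 h1 hz hy hx; grind

theorem smul_mem_hull {Γ : Set ℂ} {z : ℂ} (hz : z ∈ Γ) {t : ℝ} (h0 : 0 ≤ t) (h1 : t ≤ 1) :
    (t : ℂ) * z ∈ convexHull ℝ (Γ ∪ {0}) := by
  have := (convex_convexHull ℝ (Γ ∪ {0})) (subset_convexHull ℝ _ (Or.inl hz))
    (subset_convexHull ℝ _ (Or.inr rfl)) h0 (sub_nonneg.2 h1) (by ring)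
  simpa using this

theorem norm_le_one_of_mem_hull {Φ : ℂ → ℂ} (hΦ : Continuous Φ) {Γ : Set ℂ}
    (hnt : Γ.Nontrivial) (hlev : ∀ z ∈ Γ, ‖Φ z‖ = 1)
    (hhull : OmegaSet Γ ⊆ {z : ℂ | ‖Φ z‖ < 1}) {z : ℂ} (hz : z ∈ convexHull ℝ (Γ ∪ {0})) :
    ‖Φ z‖ ≤ 1 := by
  have hne : ∀ z ∈ convexHull ℝ (Γ ∪ {0}), z ≠ 0 → ‖Φ z‖ ≤ 1 := by
    intro z hz h0
    by_cases hΓ : z ∈ Γ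
    · exact (hlev z hΓ).le
    · exact (hhull ⟨hz, by simp [hΓ, h0]⟩).le
  rcases eq_or_ne z 0 with rfl | h0
  · obtain ⟨w, hw, hw0⟩ := hnt.exists_ne 0
    have hc : Tendsto (fun t : ℝ => ‖Φ ((t : ℂ) * w)‖) (𝓝[>] 0) (𝓝 ‖Φ 0‖) := by
      have : Continuous fun t : ℝ => ‖Φ ((t : ℂ) * w)‖ := by fun_prop
      simpa using (this.tendsto 0).mono_left nhdsWithin_le_nhds
    refine le_of_tendsto hc ?_
    filter_upwards [Ioo_mem_nhdsGT (zero_lt_one' ℝ)] with t ht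
    exact hne _ (smul_mem_hull hw ht.1.le ht.2.le) (by simp [ht.1.ne', hw0])
  · exact hne z hz h0

theorem exists_deriv_ne_zero {Φ : ℂ → ℂ} (hΦ : Differentiable ℂ Φ) {Γ : Set ℂ}
    (harc : StrictlyConvexArc Γ) (hnt : Γ.Nontrivial) (hlev : ∀ z ∈ Γ, ‖Φ z‖ = 1)
    (hhull : OmegaSet Γ ⊆ {z : ℂ | ‖Φ z‖ < 1}) : ∃ z, deriv Φ z ≠ 0 := by
  by_contra! hcon
  have hconst := is_const_of_deriv_eq_zero hΦ hcon
  obtain ⟨x, hx, y, hy, hxy⟩ := hnt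
  have hmem : ∀ t ∈ Icc (0:ℝ) 1, x + t * (y - x) ∈ Γ ∪ {0} := by
    intro t ht
    by_contra hn
    have hlt : ‖Φ (x + t * (y - x))‖ < 1 := by
      refine hhull ⟨?_, hn⟩
      have := (convex_convexHull ℝ (Γ ∪ {0})) (subset_convexHull ℝ _ (Or.inl hx))
        (subset_convexHull ℝ _ (Or.inl hy)) (sub_nonneg.2 ht.2) ht.1 (by ring)
      convert this using 1
      simp; ring
    rw [hconst _ x, hlev x hx] at hlt
    exact lt_irrefl _ hlt
  have hinj : ∀ s t : ℝ, x + s * (y - x) = x + t * (y - x) → s = t := by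
    intro s t h
    have := mul_right_cancel₀ (sub_ne_zero.2 hxy.symm) (add_left_cancel h)
    exact_mod_cast this
  have hΓ : ∀ t ∈ Icc (0:ℝ) 1, x + t * (y - x) ≠ 0 → x + t * (y - x) ∈ Γ := fun t ht h0 =>
    (hmem t ht).resolve_right h0
  have h0 : x + (0:ℝ) * (y - x) ∈ Γ := by simpa using hx
  have h1 : x + (1:ℝ) * (y - x) ∈ Γ := by simpa using hy
  have key : ∀ t ∈ Ioo (0:ℝ) 1, x + t * (y - x) = 0 := by
    intro t ht
    by_contra hn
    rcases harc.eq_of_collinear x (y - x) h0 (hΓ t (Ioo_subset_Icc_self ht) hn) h1 with h | h | h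
    · exact ht.1.ne (hinj _ _ h)
    · exact zero_ne_one (hinj _ _ h)
    · exact ht.2.ne (hinj _ _ h)
  have := hinj (1/2) (1/3) ((key _ (by norm_num)).trans (key _ (by norm_num)).symm)
  norm_num at this

/-- Some chart by a local logarithm of `Φ` meets `Γ` in exactly a level set. -/
theorem exists_isLocalLog_levelSet {Φ : ℂ → ℂ} (hΦ : Differentiable ℂ Φ) {Γ : Set ℂ}
    (harc : StrictlyConvexArc Γ) (hnt : Γ.Nontrivial) (hlev : ∀ z ∈ Γ, ‖Φ z‖ = 1)
    (hhull : OmegaSet Γ ⊆ {z : ℂ | ‖Φ z‖ < 1}) :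
    ∃ (e : OpenPartialHomeomorph ℂ ℂ) (z₁ : ℂ), z₁ ∈ e.source ∧ z₁ ∈ Γ ∧ IsLocalLog Φ e ∧
      (0 : ℂ) ∉ e.source ∧ ∀ z ∈ e.source, (e z).re = 0 → z ∈ Γ := by
  obtain ⟨zd, hzd⟩ := exists_deriv_ne_zero hΦ harc hnt hlev hhull
  obtain ⟨γ, hγc, hγi, rfl⟩ := harc.1
  have hcat : ∀ t ∈ Ioo (0:ℝ) 1, ContinuousAt γ t := fun t ht =>
    hγc.continuousAt (Icc_mem_nhds ht.1 ht.2)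
  have hIcc : ∀ {t}, t ∈ Ioo (0:ℝ) 1 → t ∈ Icc (0:ℝ) 1 := fun h => Ioo_subset_Icc_self h
  -- a point of the open arc where `Φ` is a local diffeomorphism
  obtain ⟨t₀, ht₀, hz0, hd0⟩ : ∃ t₀ ∈ Ioo (0:ℝ) 1, γ t₀ ≠ 0 ∧ deriv Φ (γ t₀) ≠ 0 := by
    by_contra! hcon
    obtain ⟨τ, hτ, hτ0⟩ : ∃ τ ∈ Ioo (0:ℝ) 1, γ τ ≠ 0 := by
      by_contra! h
      have h2 : (1/2 : ℝ) ∈ Ioo (0:ℝ) 1 := by norm_num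
      have h3 : (1/3 : ℝ) ∈ Ioo (0:ℝ) 1 := by norm_num
      have := hγi (hIcc h2) (hIcc h3) ((h _ h2).trans (h _ h3).symm)
      norm_num at this
    have hev : ∀ᶠ t in 𝓝[≠] τ, t ∈ Ioo (0:ℝ) 1 ∧ γ t ≠ 0 :=
      nhdsWithin_le_nhds ((isOpen_Ioo.eventually_mem hτ).and
        ((hcat τ hτ).eventually_ne hτ0))
    have htend : Tendsto γ (𝓝[≠] τ) (𝓝[≠] (γ τ)) := by
      refine tendsto_nhdsWithin_iff.2 ⟨(hcat τ hτ).mono_left nhdsWithin_le_nhds, ?_⟩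
      filter_upwards [hev, self_mem_nhdsWithin] with t ht hne h
      exact hne (hγi (hIcc ht.1) (hIcc hτ) h)
    have hfreq : ∃ᶠ z in 𝓝[≠] (γ τ), deriv Φ z = 0 :=
      htend.frequently (hev.mono fun t ht => hcon t ht.1 ht.2).frequently
    have hz : deriv Φ = fun _ => 0 :=
      AnalyticOnNhd.eq_of_frequently_eq
        (fun z _ => (hΦ.analyticAt z).deriv) (fun z _ => analyticAt_const) hfreq
    exact hzd (by rw [hz])
  have hγ0 : γ t₀ ∈ γ '' Icc 0 1 := mem_image_of_mem _ (hIcc ht₀)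
  obtain ⟨e, he1, he⟩ := exists_isLocalLog hΦ (hlev _ hγ0) hd0
  -- restrict to a parameter interval on which the arc stays in the chart
  have hpre : ∀ᶠ t in 𝓝 t₀, t ∈ Ioo (0:ℝ) 1 ∧ γ t ∈ e.source :=
    (isOpen_Ioo.eventually_mem ht₀).and
      ((hcat _ ht₀).eventually (e.open_source.mem_nhds he1))
  obtain ⟨δ, hδ, hball⟩ := Metric.eventually_nhds_iff_ball.1 hpre
  have hJ : ∀ t ∈ Icc (t₀ - δ/2) (t₀ + δ/2), t ∈ Ioo (0:ℝ) 1 ∧ γ t ∈ e.source := by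
    intro t ht
    apply hball
    rw [Metric.mem_ball, Real.dist_eq, abs_lt]
    constructor <;> linarith [ht.1, ht.2]
  have hre : ∀ z ∈ e.source, z ∈ γ '' Icc 0 1 → (e z).re = 0 := by
    intro z hz hzΓ
    have := he.norm_eq z hz
    rw [hlev z hzΓ] at this
    exact (Real.exp_eq_one_iff _).1 this.symm
  set y : ℝ → ℝ := fun t => (e (γ t)).im with hy
  have hext : ∀ t ∈ Icc (t₀ - δ/2) (t₀ + δ/2), ∀ z ∈ e.source, (e z).re = 0 →
      y t = (e z).im → z = γ t := by
    intro t ht z hz h0 him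
    refine e.injOn hz (hJ t ht).2 (Complex.ext ?_ him.symm)
    rw [h0, hre _ (hJ t ht).2 (mem_image_of_mem _ (hIcc (hJ t ht).1))]
  have hyc : ContinuousOn y (Icc (t₀ - δ/2) (t₀ + δ/2)) := by
    refine Complex.continuous_im.comp_continuousOn (e.continuousOn.comp ?_ fun t ht => (hJ t ht).2)
    exact hγc.mono fun t ht => hIcc (hJ t ht).1
  have hyi : InjOn y (Icc (t₀ - δ/2) (t₀ + δ/2)) := by
    intro s hs t ht hst
    refine hγi (hIcc (hJ s hs).1) (hIcc (hJ t ht).1) (hext t ht _ (hJ s hs).2 ?_ hst.symm)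
    exact hre _ (hJ s hs).2 (mem_image_of_mem _ (hIcc (hJ s hs).1))
  have hle : t₀ - δ/2 ≤ t₀ + δ/2 := by linarith
  have hnhds : y '' Icc (t₀ - δ/2) (t₀ + δ/2) ∈ 𝓝 (y t₀) := by
    have hl := left_mem_Icc.2 hle
    have hr := right_mem_Icc.2 hle
    have hm : t₀ ∈ Icc (t₀ - δ/2) (t₀ + δ/2) := ⟨by linarith, by linarith⟩
    rcases hyc.strictMonoOn_of_injOn_Icc' hle hyi with h | h
    · exact mem_of_superset (Icc_mem_nhds (h hl hm (by linarith)) (h hm hr (by linarith)))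
        (intermediate_value_Icc hle hyc)
    · exact mem_of_superset (Icc_mem_nhds (h hm hr (by linarith)) (h hl hm (by linarith)))
        (intermediate_value_Icc' hle hyc)
  obtain ⟨V, hVsub, hVo, hV0⟩ := mem_nhds_iff.1 hnhds
  set S : Set ℂ := e.source ∩ (fun z => (e z).im) ⁻¹' V with hS
  have hSo : IsOpen S :=
    (Complex.continuous_im.comp_continuousOn e.continuousOn).isOpen_inter_preimage
      e.open_source hVo
  refine ⟨e.restrOpen (S ∩ {0}ᶜ) (hSo.inter isOpen_compl_singleton), γ t₀,
    ⟨he1, ⟨he1, hV0⟩, hz0⟩, hγ0, he.restrOpen _ _, fun h => h.2.2 rfl, ?_⟩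
  rintro z ⟨hz, ⟨-, hzV⟩, -⟩ h0
  obtain ⟨t, ht, hty⟩ := hVsub hzV
  rw [hext t ht z hz h0 hty]
  exact mem_image_of_mem _ (hIcc (hJ t ht).1)

/-- The arc cannot be straight nor bend the wrong way: at some point of it the sublevel set of `Φ`
is strictly convex to second order. -/
theorem exists_curvature_neg {Φ : ℂ → ℂ} {Γ : Set ℂ}
    (harc : StrictlyConvexArc Γ) (hlev : ∀ z ∈ Γ, ‖Φ z‖ = 1)
    (hle : ∀ z ∈ convexHull ℝ (Γ ∪ {0}), ‖Φ z‖ ≤ 1)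
    {e : OpenPartialHomeomorph ℂ ℂ} (he : IsLocalLog Φ e) {z₁ : ℂ} (hz₁ : z₁ ∈ e.source)
    (hz₁Γ : z₁ ∈ Γ) (heΓ : ∀ z ∈ e.source, (e z).re = 0 → z ∈ Γ) :
    ∃ z₀ ∈ e.source, z₀ ∈ Γ ∧ (deriv (deriv e) z₀ / deriv e z₀ ^ 2).re < 0 := by
  by_contra! hcon
  have hre1 : (e z₁).re = 0 := by
    have := he.norm_eq z₁ hz₁
    rw [hlev z₁ hz₁Γ] at this
    exact (Real.exp_eq_one_iff _).1 this.symm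
  obtain ⟨η, hη, hball⟩ := Metric.isOpen_iff.1 e.open_target _ (e.map_source hz₁)
  set w : ℝ → ℂ := fun θ => e z₁ + θ * Complex.I with hw
  have hwd : ∀ θ, HasDerivAt w Complex.I θ := fun θ => by
    simpa [hw] using ((Complex.ofRealCLM.hasDerivAt (x := θ)).mul_const Complex.I).const_add (e z₁)
  have hwt : ∀ θ ∈ Ioo (-η) η, w θ ∈ e.target := by
    intro θ hθ
    apply hball
    simpa [hw, abs_lt] using hθ
  set C : ℝ → ℂ := fun θ => e.symm (w θ) with hC
  have hCs : ∀ θ ∈ Ioo (-η) η, C θ ∈ e.source := fun θ hθ => e.map_target (hwt θ hθ)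
  have heC : ∀ θ ∈ Ioo (-η) η, e (C θ) = w θ := fun θ hθ => e.right_inv (hwt θ hθ)
  have hCre : ∀ θ ∈ Ioo (-η) η, (e (C θ)).re = 0 := fun θ hθ => by
    rw [heC θ hθ]; simp [hw, hre1]
  have hCΓ : ∀ θ ∈ Ioo (-η) η, C θ ∈ Γ := fun θ hθ => heΓ _ (hCs θ hθ) (hCre θ hθ)
  have hCinj : ∀ s ∈ Ioo (-η) η, ∀ t ∈ Ioo (-η) η, C s = C t → s = t := by
    intro s hs t ht hst
    have := heC s hs
    rw [hst, heC t ht] at this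
    simpa [hw] using this.symm
  have hCd : ∀ θ ∈ Ioo (-η) η, HasDerivAt C ((deriv e (C θ))⁻¹ * Complex.I) θ := by
    intro θ hθ
    exact (e.hasDerivAt_symm (hwt θ hθ) (he.deriv_ne_zero _ (hCs θ hθ))
      (he.hasDerivAt (hCs θ hθ))).comp_of_eq θ (hwd θ) rfl
  -- the curvature vanishes along the arc
  have hflat : ∀ θ ∈ Ioo (-η) η, (deriv (deriv e) (C θ) / deriv e (C θ) ^ 2).re = 0 := by
    intro θ hθ
    refine le_antisymm ?_ (hcon _ (hCs θ hθ) (hCΓ θ hθ))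
    by_contra! hpos
    have hev : ∀ᶠ z in 𝓝 (C θ), z ∈ e.source ∧ 0 < (deriv (deriv e) z / deriv e z ^ 2).re :=
      (e.open_source.eventually_mem (hCs θ hθ)).and
        ((he.continuousAt_curvature (hCs θ hθ)).eventually (lt_mem_nhds hpos))
    obtain ⟨R, hR, hB⟩ := Metric.eventually_nhds_iff_ball.1 hev
    have hev2 : ∀ᶠ t in 𝓝[≠] θ, (t ∈ Ioo (-η) η ∧ C t ∈ Metric.ball (C θ) R) ∧ t ≠ θ :=
      (((isOpen_Ioo.eventually_mem hθ).and ((hCd θ hθ).continuousAt.eventually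
        (Metric.ball_mem_nhds _ hR))).filter_mono nhdsWithin_le_nhds).and self_mem_nhdsWithin
    obtain ⟨t, ⟨ht, htB⟩, htne⟩ := hev2.exists
    have hCne : C θ ≠ C t := fun h => htne (hCinj _ ht _ hθ h.symm)
    have hdn : deriv (fun z => -e z) = fun z => -deriv e z := by
      funext z; exact deriv.fun_neg
    have hmid : midpoint ℝ (C θ) (C t) ∈ openSegment ℝ (C θ) (C t) :=
      ⟨1/2, 1/2, by norm_num, by norm_num, by norm_num, by
        rw [midpoint_eq_smul_add]; simp⟩
    have hlt := re_lt_max_of_mem_openSegment (F := fun z => -e z) Metric.isOpen_ball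
      (convex_ball (C θ) R) (he.differentiableOn.mono fun z hz => (hB z hz).1).neg
      (fun z hz => by rw [hdn]; exact neg_ne_zero.2 (he.deriv_ne_zero z (hB z hz).1))
      (fun z hz => by
        rw [hdn, deriv.fun_neg, neg_sq, neg_div, Complex.neg_re]
        exact neg_neg_of_pos (hB z hz).2)
      (Metric.mem_ball_self hR) htB hCne hmid
    simp only [Complex.neg_re, hCre θ hθ, hCre t ht, neg_zero, max_self] at hlt
    have hmB : midpoint ℝ (C θ) (C t) ∈ Metric.ball (C θ) R :=
      (convex_ball (C θ) R).openSegment_subset (Metric.mem_ball_self hR) htB hmid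
    have h1 := hle _ (((convex_convexHull ℝ (Γ ∪ {0})).openSegment_subset
      (subset_convexHull ℝ _ (Or.inl (hCΓ θ hθ))) (subset_convexHull ℝ _ (Or.inl (hCΓ t ht))))
      hmid)
    rw [he.norm_eq _ (hB _ hmB).1, Real.exp_le_one_iff] at h1
    linarith
  -- hence the tangent direction is constant
  set k : ℝ → ℂ := fun θ => (deriv e (C θ))⁻¹ with hk
  have hk0 : ∀ θ ∈ Ioo (-η) η, k θ ≠ 0 := fun θ hθ => inv_ne_zero (he.deriv_ne_zero _ (hCs θ hθ))
  have hkd : ∀ θ ∈ Ioo (-η) η, ∃ ρ : ℝ, HasDerivAt k (ρ * k θ) θ := by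
    intro θ hθ
    have h0 := hflat θ hθ
    have hne := he.deriv_ne_zero _ (hCs θ hθ)
    have hd : HasDerivAt k (-(deriv (deriv e) (C θ) * ((deriv e (C θ))⁻¹ * Complex.I)) /
        deriv e (C θ) ^ 2) θ :=
      ((he.hasDerivAt_deriv (hCs θ hθ)).comp_of_eq θ (hCd θ hθ) rfl).fun_inv hne
    set q := deriv (deriv e) (C θ) / deriv e (C θ) ^ 2 with hq
    refine ⟨q.im, ?_⟩
    have hqi : q = q.im * Complex.I := by apply Complex.ext <;> simp [h0]
    have hqim : (q.im : ℂ) = -(q * Complex.I) := by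
      rw [hqi]; simp [mul_assoc]
    convert hd using 1
    rw [hqim, hq, hk]
    field_simp
  have hconst : ∀ θ ∈ Ioo (-η) η, star (k θ) / k θ = star (k 0) / k 0 := by
    have hder : ∀ θ ∈ Ioo (-η) η, HasDerivAt (fun θ => star (k θ) / k θ) 0 θ := by
      intro θ hθ
      obtain ⟨ρ, hρ⟩ := hkd θ hθ
      have h := hρ.star.fun_div hρ (hk0 θ hθ)
      have h0 : (star (ρ * k θ) * k θ - star (k θ) * (ρ * k θ)) / k θ ^ 2 = 0 := by
        simp; ring_nf; simp
      rwa [h0] at h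
    intro θ hθ
    exact isOpen_Ioo.is_const_of_deriv_eq_zero isPreconnected_Ioo
      (fun t ht => (hder t ht).differentiableAt.differentiableWithinAt)
      (fun t ht => (hder t ht).deriv) hθ ⟨by linarith, hη⟩
  have h0I : (0:ℝ) ∈ Ioo (-η) η := ⟨by linarith, hη⟩
  have hreal : ∀ θ ∈ Ioo (-η) η, (k θ / k 0).im = 0 := by
    intro θ hθ
    rw [← Complex.conj_eq_iff_im, map_div₀]
    have := hconst θ hθ
    rw [div_eq_div_iff (hk0 θ hθ) (hk0 0 h0I)] at this
    rw [div_eq_div_iff ((map_ne_zero _).2 (hk0 0 h0I)) (hk0 0 h0I)]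
    simpa [mul_comm] using this
  have hline : ∀ θ ∈ Ioo (-η) η, ∃ x : ℝ, C θ = C 0 + x * (k 0 * Complex.I) := by
    have hder : ∀ θ ∈ Ioo (-η) η,
        HasDerivAt (fun θ => ((C θ - C 0) / (k 0 * Complex.I)).im) 0 θ := by
      intro θ hθ
      have h1 := ((hCd θ hθ).sub_const (C 0)).div_const (k 0 * Complex.I)
      have h2 : HasDerivAt (fun θ => ((C θ - C 0) / (k 0 * Complex.I)).im)
          (k θ * Complex.I / (k 0 * Complex.I)).im θ :=
        Complex.imCLM.hasFDerivAt.comp_hasDerivAt θ h1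
      rwa [mul_div_mul_right _ _ Complex.I_ne_zero, hreal θ hθ] at h2
    intro θ hθ
    have h := isOpen_Ioo.is_const_of_deriv_eq_zero isPreconnected_Ioo
      (fun t ht => (hder t ht).differentiableAt.differentiableWithinAt)
      (fun t ht => (hder t ht).deriv) hθ h0I
    simp only [sub_self, zero_div, Complex.zero_im] at h
    refine ⟨((C θ - C 0) / (k 0 * Complex.I)).re, ?_⟩
    have h3 : ((((C θ - C 0) / (k 0 * Complex.I)).re : ℝ) : ℂ)
        = (C θ - C 0) / (k 0 * Complex.I) := by
      apply Complex.ext <;> simp [h]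
    rw [h3, div_mul_cancel₀ _ (mul_ne_zero (hk0 0 h0I) Complex.I_ne_zero)]
    ring
  have haI : η / 2 ∈ Ioo (-η) η := ⟨by linarith, by linarith⟩
  have hbI : η / 3 ∈ Ioo (-η) η := ⟨by linarith, by linarith⟩
  obtain ⟨x, hx⟩ := hline 0 h0I
  obtain ⟨y, hy⟩ := hline _ haI
  obtain ⟨z, hz⟩ := hline _ hbI
  have h := harc.eq_of_collinear (C 0) (k 0 * Complex.I) (hx ▸ hCΓ 0 h0I) (hy ▸ hCΓ _ haI)
    (hz ▸ hCΓ _ hbI)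
  rw [← hx, ← hy, ← hz] at h
  rcases h with h | h | h
  · have := hCinj _ h0I _ haI h; linarith
  · have := hCinj _ h0I _ hbI h; linarith
  · have := hCinj _ haI _ hbI h; linarith

/-- Points near `z₀ ∈ Γ` are radial multiples, with factor close to `1`, of points of `Γ`. -/
theorem eventually_exists_radial {Φ : ℂ → ℂ} {Γ : Set ℂ} (harc : StrictlyConvexArc Γ)
    (hhull : OmegaSet Γ ⊆ {z : ℂ | ‖Φ z‖ < 1})
    {e : OpenPartialHomeomorph ℂ ℂ} (he : IsLocalLog Φ e)
    (heΓ : ∀ z ∈ e.source, (e z).re = 0 → z ∈ Γ) {B : Set ℂ} (hBo : IsOpen B)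
    (hBc : Convex ℝ B) (hBe : B ⊆ e.source) (hB0 : (0 : ℂ) ∉ B)
    (hquasi : ∀ p ∈ B, ∀ q ∈ B, p ≠ q → ∀ x ∈ openSegment ℝ p q,
      (e x).re < max (e p).re (e q).re)
    {z₀ : ℂ} (hz₀ : z₀ ∈ B) (hz₀Γ : z₀ ∈ Γ) (hre0 : (e z₀).re = 0) {c : ℝ} (hc : c < 1) :
    ∀ᶠ q in 𝓝 z₀, ∃ ρ : ℝ, c < ρ ∧ 0 < ρ ∧ (ρ : ℂ) * q ∈ Γ ∩ B := by
  have hz0 : z₀ ≠ 0 := fun h => hB0 (h ▸ hz₀)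
  have hcont : Continuous fun ρ : ℝ => (ρ : ℂ) * z₀ := by fun_prop
  have hmem : ∀ᶠ ρ : ℝ in 𝓝 1, (ρ : ℂ) * z₀ ∈ B :=
    hcont.continuousAt.eventually (hBo.mem_nhds (by simpa using hz₀))
  have hnorm : ∀ z ∈ B, ‖Φ z‖ < 1 → (e z).re < 0 := fun z hz h => by
    rwa [he.norm_eq z (hBe hz), Real.exp_lt_one_iff] at h
  have hinj : ∀ s t : ℝ, (0:ℂ) + s * z₀ = 0 + t * z₀ → s = t := fun s t h => by
    simpa [hz0] using h
  obtain ⟨δ, hδ, hball⟩ := Metric.eventually_nhds_iff_ball.1 hmem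
  obtain ⟨ρ₁, hcρ, hρ0, hρ1, hρB, hneg⟩ : ∃ ρ₁ : ℝ, c < ρ₁ ∧ 0 < ρ₁ ∧ ρ₁ < 1 ∧
      (ρ₁ : ℂ) * z₀ ∈ B ∧ (e (ρ₁ * z₀)).re < 0 := by
    by_contra! hcon
    set b := max (max c 0) (1 - δ) with hb
    have hb1 : b < 1 := by simp [hb, hc, hδ]
    have hbc : c ≤ b := (le_max_left c 0).trans (le_max_left _ _)
    have hb0 : 0 ≤ b := (le_max_right c 0).trans (le_max_left _ _)
    have hbδ : 1 - δ ≤ b := le_max_right _ _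
    have hΓ : ∀ ρ ∈ Ioo b 1, (0:ℂ) + ρ * z₀ ∈ Γ := by
      intro ρ hρ
      rw [zero_add]
      have hρB : (ρ : ℂ) * z₀ ∈ B := by
        apply hball
        rw [Metric.mem_ball, Real.dist_eq, abs_lt]
        constructor <;> linarith [hρ.1, hρ.2]
      have h := hcon ρ (hbc.trans_lt hρ.1) (hb0.trans_lt hρ.1) hρ.2 hρB
      by_contra hn
      have hΩ : (ρ : ℂ) * z₀ ∈ OmegaSet Γ :=
        ⟨smul_mem_hull hz₀Γ (hb0.trans hρ.1.le) hρ.2.le, fun h' => h'.elim hn fun h0 =>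
          hB0 (h0 ▸ hρB)⟩
      exact h.not_gt (hnorm _ hρB (hhull hΩ))
    have h1 : (0:ℂ) + (1:ℝ) * z₀ ∈ Γ := by simpa using hz₀Γ
    have h2 : (b + 1) / 2 ∈ Ioo b 1 := ⟨by linarith, by linarith⟩
    have h3 : (2 * b + 1) / 3 ∈ Ioo b 1 := ⟨by linarith, by linarith⟩
    rcases harc.eq_of_collinear 0 z₀ h1 (hΓ _ h2) (hΓ _ h3) with h | h | h
    · exact h2.2.ne' (hinj _ _ h)
    · exact h3.2.ne' (hinj _ _ h)
    · have := hinj _ _ h; linarith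
  obtain ⟨ρ₂, hρ2, hρ2B⟩ : ∃ ρ₂ : ℝ, 1 < ρ₂ ∧ (ρ₂ : ℂ) * z₀ ∈ B := by
    refine ⟨1 + δ / 2, by linarith, hball _ ?_⟩
    rw [Metric.mem_ball, Real.dist_eq, abs_lt]
    constructor <;> linarith
  have hpos : 0 < (e (ρ₂ * z₀)).re := by
    have hseg : z₀ ∈ openSegment ℝ ((ρ₁ : ℂ) * z₀) (ρ₂ * z₀) := by
      have h12 : 0 < ρ₂ - ρ₁ := by linarith
      refine ⟨(ρ₂ - 1) / (ρ₂ - ρ₁), (1 - ρ₁) / (ρ₂ - ρ₁), div_pos (by linarith) h12,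
        div_pos (by linarith) h12, by field_simp; ring, ?_⟩
      have h12' : (ρ₂ : ℂ) - ρ₁ ≠ 0 := by exact_mod_cast h12.ne'
      simp only [Complex.real_smul, Complex.ofReal_div, Complex.ofReal_sub, Complex.ofReal_one]
      field_simp
      ring
    have hne : (ρ₁ : ℂ) * z₀ ≠ ρ₂ * z₀ := fun h => by
      have := hinj ρ₁ ρ₂ (by simpa using h); linarith
    have := hquasi _ hρB _ hρ2B hne _ hseg
    rw [hre0, lt_max_iff] at this
    exact this.resolve_left hneg.not_gt
  have hmul : ∀ ρ : ℝ, ContinuousAt (fun q : ℂ => (ρ : ℂ) * q) z₀ := fun ρ => by fun_prop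
  have hrec : ∀ ρ : ℝ, (ρ : ℂ) * z₀ ∈ B →
      ContinuousAt (fun q : ℂ => (e ((ρ : ℂ) * q)).re) z₀ := fun ρ hρ =>
    Complex.continuous_re.continuousAt.comp
      ((e.continuousAt (hBe hρ)).comp_of_eq (hmul ρ) rfl)
  filter_upwards [(hmul ρ₁).eventually (hBo.mem_nhds hρB), (hmul ρ₂).eventually
    (hBo.mem_nhds hρ2B), (hrec ρ₁ hρB).eventually (gt_mem_nhds hneg),
    (hrec ρ₂ hρ2B).eventually (lt_mem_nhds hpos)] with q h1 h2 h3 h4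
  have hseg : ∀ ρ ∈ Icc ρ₁ ρ₂, (ρ : ℂ) * q ∈ B := by
    intro ρ hρ
    rw [← segment_eq_Icc (hρ1.trans hρ2).le] at hρ
    obtain ⟨a, b, ha, hb, hab, rfl⟩ := hρ
    convert hBc h1 h2 ha hb hab using 1
    simp; ring
  have hcq : ContinuousOn (fun ρ : ℝ => (e ((ρ : ℂ) * q)).re) (Icc ρ₁ ρ₂) := by
    refine Complex.continuous_re.comp_continuousOn (e.continuousOn.comp ?_ fun ρ hρ =>
      hBe (hseg ρ hρ))
    fun_prop
  obtain ⟨ρ, hρ, h0⟩ := intermediate_value_Icc (hρ1.trans hρ2).le hcq ⟨h3.le, h4.le⟩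
  exact ⟨ρ, hcρ.trans_le hρ.1, hρ0.trans_le hρ.1, heΓ _ (hBe (hseg ρ hρ)) h0, hseg ρ hρ⟩

/-- Interior points of `conv(Γ ∪ {0})` other than `0` lie in `Ω`. -/
theorem mem_OmegaSet_of_mem_interior {Φ : ℂ → ℂ} (hΦ : Differentiable ℂ Φ)
    (hnc : ∃ z, deriv Φ z ≠ 0) {Γ : Set ℂ} (hlev : ∀ z ∈ Γ, ‖Φ z‖ = 1)
    (hle : ∀ z ∈ convexHull ℝ (Γ ∪ {0}), ‖Φ z‖ ≤ 1) {p : ℂ}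
    (hp : p ∈ interior (convexHull ℝ (Γ ∪ {0}))) (hp0 : p ≠ 0) : p ∈ OmegaSet Γ := by
  refine ⟨interior_subset hp, fun h => h.elim (fun hΓ => ?_) hp0⟩
  have hmax : IsLocalMax (norm ∘ Φ) p := by
    filter_upwards [mem_interior_iff_mem_nhds.1 hp] with z hz
    simpa [hlev p hΓ] using hle z hz
  have hev := Complex.eventually_eq_of_isLocalMax_norm (Eventually.of_forall fun z => hΦ z) hmax
  have hconst : Φ = fun _ => Φ p :=
    AnalyticOnNhd.eq_of_eventuallyEq (fun z _ => hΦ.analyticAt z) (fun z _ => analyticAt_const) hev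
  obtain ⟨z, hz⟩ := hnc
  rw [hconst] at hz
  simp at hz

/-- If a strictly quasiconvex function equals `s` on `G`, then on the convex hull of `G` it is at
most `s`, with equality only on `G`. -/
theorem re_le_and_mem_of_mem_convexHull {f : ℂ → ℝ} {B G : Set ℂ} (hBc : Convex ℝ B)
    (hquasi : ∀ p ∈ B, ∀ q ∈ B, p ≠ q → ∀ x ∈ openSegment ℝ p q, f x < max (f p) (f q))
    {s : ℝ} (hGB : G ⊆ B) (hG : ∀ z ∈ G, f z = s) {q : ℂ} (hq : q ∈ convexHull ℝ G) :
    q ∈ B ∧ f q ≤ s ∧ (f q = s → q ∈ G) := by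
  set D : Set ℂ := {z ∈ B | f z ≤ s} with hD
  have hDc : Convex ℝ D := by
    rw [convex_iff_openSegment_subset]
    intro x hx y hy z hz
    refine ⟨hBc.openSegment_subset hx.1 hy.1 hz, ?_⟩
    rcases eq_or_ne x y with rfl | hxy
    · rw [openSegment_same] at hz
      exact hz ▸ hx.2
    · exact (hquasi x hx.1 y hy.1 hxy z hz).le.trans (max_le hx.2 hy.2)
  have hsub : convexHull ℝ G ⊆ D := convexHull_min (fun z hz => ⟨hGB hz, (hG z hz).le⟩) hDc
  refine ⟨(hsub hq).1, (hsub hq).2, fun hqs => ?_⟩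
  refine extremePoints_convexHull_subset (𝕜 := ℝ) (mem_extremePoints.2 ⟨hq, ?_⟩)
  intro x hx y hy hqxy
  rcases eq_or_ne x y with rfl | hxy
  · rw [openSegment_same] at hqxy
    exact ⟨hqxy.symm, hqxy.symm⟩
  · have := hquasi x (hsub hx).1 y (hsub hy).1 hxy q hqxy
    exact absurd (hqs ▸ this) (max_le (hsub hx).2 (hsub hy).2).not_gt

/-- A level arc of a strictly quasiconvex function is strictly convex. -/
theorem strictlyConvexArc_of_level {f : ℂ → ℝ} {B G : Set ℂ} (hGa : IsCompactArc G)
    (hquasi : ∀ p ∈ B, ∀ q ∈ B, p ≠ q → ∀ x ∈ openSegment ℝ p q, f x < max (f p) (f q))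
    {s : ℝ} (hGB : G ⊆ B) (hG : ∀ z ∈ G, f z = s) : StrictlyConvexArc G := by
  refine ⟨hGa, fun z₁ h1 z₂ h2 => ?_⟩
  have key : ∀ u ∈ segment ℝ z₁ z₂ ∩ G, u = z₁ ∨ u = z₂ := by
    rintro u ⟨hu, huG⟩
    by_contra! hcon
    have hopen := mem_openSegment_of_ne_left_right hcon.1.symm hcon.2.symm hu
    rcases eq_or_ne z₁ z₂ with rfl | hne
    · rw [openSegment_same] at hopen
      exact hcon.1 hopen
    · have := hquasi _ (hGB h1) _ (hGB h2) hne _ hopen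
      rw [hG _ h1, hG _ h2, hG _ huG, max_self] at this
      exact lt_irrefl _ this
  intro u hu v hv w hw
  have := key u hu; have := key v hv; have := key w hw
  grind

/-- A chart has level arcs of its real part arbitrarily close to any given point. -/
theorem exists_level_arc (e : OpenPartialHomeomorph ℂ ℂ) {z₀ : ℂ} (hz₀ : z₀ ∈ e.source)
    {U : Set ℂ} (hU : U ∈ 𝓝 z₀) :
    ∃ s > (e z₀).re, ∃ G : Set ℂ, IsCompactArc G ∧ G.Nontrivial ∧ G ⊆ U ∧
      ∀ z ∈ G, (e z).re = s := by
  have hU' : e.symm ⁻¹' U ∈ 𝓝 (e z₀) :=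
    (e.continuousAt_symm (e.map_source hz₀)).preimage_mem_nhds (by rwa [e.left_inv hz₀])
  obtain ⟨η, hη, hball⟩ := Metric.mem_nhds_iff.1
    (inter_mem hU' (e.open_target.mem_nhds (e.map_source hz₀)))
  set w : ℝ → ℂ := fun t => e z₀ + ((η / 3 : ℝ) : ℂ) * (1 + t * Complex.I) with hw
  have hwB : ∀ t ∈ Icc (0:ℝ) 1, w t ∈ e.symm ⁻¹' U ∩ e.target := by
    intro t ht
    apply hball
    rw [Metric.mem_ball, dist_eq_norm]
    calc ‖w t - e z₀‖ = η / 3 * ‖1 + t * Complex.I‖ := by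
          simp [hw, abs_of_pos hη]
      _ ≤ η / 3 * (1 + 1) := by
          gcongr
          refine (norm_add_le _ _).trans ?_
          simpa [abs_of_nonneg ht.1] using ht.2
      _ < η := by linarith
  have hinj : InjOn (fun t => e.symm (w t)) (Icc 0 1) := by
    intro a ha b hb hab
    have := e.symm.injOn (hwB a ha).2 (hwB b hb).2 hab
    simpa [hw, hη.ne'] using this
  have hcont : ContinuousOn (fun t => e.symm (w t)) (Icc 0 1) :=
    e.symm.continuousOn.comp (by fun_prop) fun t ht => (hwB t ht).2
  refine ⟨(e z₀).re + η / 3, by linarith, (fun t => e.symm (w t)) '' Icc 0 1,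
    ⟨_, hcont, hinj, rfl⟩, ?_, ?_, ?_⟩
  · have h0 : (0:ℝ) ∈ Icc (0:ℝ) 1 := by simp
    have h1 : (1:ℝ) ∈ Icc (0:ℝ) 1 := by simp
    exact ⟨_, mem_image_of_mem _ h0, _, mem_image_of_mem _ h1,
      fun h => zero_ne_one (hinj h0 h1 h)⟩
  · rintro _ ⟨t, ht, rfl⟩
    exact (hwB t ht).1
  · rintro _ ⟨t, ht, rfl⟩
    simp only [e.right_inv (hwB t ht).2]
    simp [hw]

/-- Lemma 8 of the paper. -/
theorem stmt4 (Φ : ℂ → ℂ) (hΦ : Differentiable ℂ Φ) (a : ℕ → ℂ)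
    (hrep : ∀ z : ℂ, HasSum (fun n : ℕ => a n * z ^ n) (Φ z))
    (htype : ExpType a)
    (Γ₁ : Set ℂ) (harc : StrictlyConvexArc Γ₁) (hnt : Γ₁.Nontrivial)
    (hlev : ∀ z ∈ Γ₁, ‖Φ z‖ = 1)
    (hhull : convexHull ℝ (Γ₁ ∪ {0}) \ (Γ₁ ∪ {0}) ⊆ {z : ℂ | ‖Φ z‖ < 1})
    (m : ℕ) (hm : 1 ≤ m) :
    ∃ r > (1:ℝ), ∃ Γ : Set ℂ, ∃ ε > (0:ℝ),
      StrictlyConvexArc Γ ∧ Γ.Nontrivial ∧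
      Γ ⊆ {z : ℂ | ‖Φ z‖ = r} ∩ {w : ℂ | ∃ t : ℝ, 0 < t ∧ ∃ z ∈ Γ₁, w = (t : ℂ) * z} ∧
      -- (i)
      convexHull ℝ (Γ ∪ {0}) \ Γ ⊆ {z : ℂ | ‖Φ z‖ < r} ∧
      -- (ii)
      (∀ j, 1 ≤ j → j < m →
        (∀ g : Fin j → ℂ, (∀ i, g i ∈ Γ) → (∑ i, g i) / (m : ℂ) ∈ OmegaSet Γ₁) ∧
        (∀ l ∈ OmegaSet Γ₁ ∩ {z : ℂ | ‖z‖ < ε} ∩ convexHull ℝ (Γ ∪ {0}),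
          ∀ g : Fin j → ℂ, (∀ i, g i ∈ Γ) →
            l + (∑ i, g i) / (m : ℂ) ∈ OmegaSet Γ₁)) := by
  have hhull' : OmegaSet Γ₁ ⊆ {z : ℂ | ‖Φ z‖ < 1} := hhull
  have hnc := exists_deriv_ne_zero hΦ harc hnt hlev hhull'
  have hle : ∀ z ∈ convexHull ℝ (Γ₁ ∪ {0}), ‖Φ z‖ ≤ 1 := fun z hz =>
    norm_le_one_of_mem_hull hΦ.continuous hnt hlev hhull' hz
  obtain ⟨e, z₁, hz₁, hz₁Γ, he, he0, heΓ⟩ := exists_isLocalLog_levelSet hΦ harc hnt hlev hhull'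
  obtain ⟨z₀, hz₀, hz₀Γ, hcurv⟩ := exists_curvature_neg harc hlev hle he hz₁ hz₁Γ heΓ
  have hre : ∀ z ∈ e.source, z ∈ Γ₁ → (e z).re = 0 := by
    intro z hz hzΓ
    have := he.norm_eq z hz
    rw [hlev z hzΓ] at this
    exact (Real.exp_eq_one_iff _).1 this.symm
  obtain ⟨R, hR, hB⟩ := Metric.eventually_nhds_iff_ball.1
    ((e.open_source.eventually_mem hz₀).and
      ((he.continuousAt_curvature hz₀).eventually (gt_mem_nhds hcurv)))
  have hquasi : ∀ p ∈ Metric.ball z₀ R, ∀ q ∈ Metric.ball z₀ R, p ≠ q →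
      ∀ x ∈ openSegment ℝ p q, (e x).re < max (e p).re (e q).re := fun p hp q hq hpq x hx =>
    re_lt_max_of_mem_openSegment Metric.isOpen_ball (convex_ball z₀ R)
      (he.differentiableOn.mono fun z hz => (hB z hz).1)
      (fun z hz => he.deriv_ne_zero z (hB z hz).1) (fun z hz => (hB z hz).2) hp hq hpq hx
  have hm0 : (0:ℝ) < m := by exact_mod_cast hm
  have hc : ((m:ℝ) - 1) / m < 1 := by rw [div_lt_one hm0]; linarith
  have hrad := eventually_exists_radial harc hhull' he heΓ Metric.isOpen_ball (convex_ball z₀ R)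
    (fun z hz => (hB z hz).1) (fun h => he0 (hB 0 h).1) hquasi (Metric.mem_ball_self hR) hz₀Γ
    (hre z₀ hz₀ hz₀Γ) hc
  obtain ⟨δ, hδ, hnear⟩ := Metric.eventually_nhds_iff_ball.1
    ((Metric.isOpen_ball.eventually_mem (Metric.mem_ball_self hR)).and hrad)
  obtain ⟨s, hs, G, hGa, hGnt, hGU, hGs⟩ := exists_level_arc e hz₀
    (Metric.ball_mem_nhds z₀ (half_pos hδ))
  rw [hre z₀ hz₀ hz₀Γ] at hs
  have hball : Metric.ball z₀ (δ / 2) ⊆ Metric.ball z₀ δ :=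
    Metric.ball_subset_ball (by linarith)
  have hGB : G ⊆ Metric.ball z₀ R := fun z hz => (hnear z (hball (hGU hz))).1
  have hscale : ∀ j : ℕ, 1 ≤ j → j < m → ∀ q ∈ Metric.ball z₀ δ,
      (((j / m : ℝ)) : ℂ) * q ∈ OmegaSet Γ₁ := by
    intro j hj1 hjm q hq
    have hj0 : (0:ℝ) < j := by exact_mod_cast hj1
    have hjm' : (j:ℝ) ≤ m - 1 := by
      have : (j:ℝ) + 1 ≤ m := by exact_mod_cast hjm
      linarith
    have ha0 : (0:ℝ) < j / m := div_pos hj0 hm0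
    have ha0' : ((j / m : ℝ) : ℂ) ≠ 0 := by exact_mod_cast ha0.ne'
    have hac : (j / m : ℝ) ≤ ((m:ℝ) - 1) / m := by gcongr
    refine mem_OmegaSet_of_mem_interior hΦ hnc hlev hle (mem_interior.2
      ⟨(fun p => p / ((j / m : ℝ) : ℂ)) ⁻¹' Metric.ball z₀ δ, ?_,
        Metric.isOpen_ball.preimage (by fun_prop), ?_⟩) ?_
    · intro p hp
      obtain ⟨-, ρ, hcρ, hρ0, hρΓ, -⟩ := hnear _ hp
      have := smul_mem_hull hρΓ (div_pos ha0 hρ0).le ((div_le_one hρ0).2 (hac.trans hcρ.le))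
      convert this using 1
      have : (ρ : ℂ) ≠ 0 := by exact_mod_cast hρ0.ne'
      rw [Complex.ofReal_div (j / m : ℝ) ρ]
      field_simp
    · rwa [mem_preimage, mul_div_cancel_left₀ _ ha0']
    · exact mul_ne_zero ha0' fun h => he0 (hB 0 (h ▸ (hnear q hq).1)).1
  have hsum : ∀ j : ℕ, 1 ≤ j → j < m → ∀ l : ℂ, ‖l‖ < δ / (2 * m) → ∀ g : Fin j → ℂ,
      (∀ i, g i ∈ G) → l + (∑ i, g i) / (m : ℂ) ∈ OmegaSet Γ₁ := by
    intro j hj1 hjm l hl g hg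
    have hj1' : (1:ℝ) ≤ j := by exact_mod_cast hj1
    have hj0 : (0:ℝ) < j := by linarith
    have hmc : (m:ℂ) ≠ 0 := by exact_mod_cast hm0.ne'
    have hjc : (j:ℂ) ≠ 0 := by exact_mod_cast hj0.ne'
    have hav : (∑ i, g i) / (j : ℂ) ∈ Metric.ball z₀ (δ / 2) := by
      have := (convex_ball z₀ (δ / 2)).sum_mem (t := Finset.univ) (w := fun _ : Fin j => (j:ℝ)⁻¹)
        (z := g) (fun _ _ => by positivity) (by simp [hj0.ne']) fun i _ => hGU (hg i)
      convert this using 1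
      rw [← Finset.smul_sum]
      simp [div_eq_inv_mul]
    have hl' : ‖(m / j : ℂ) * l‖ < δ / 2 := by
      rw [norm_mul, norm_div, Complex.norm_natCast, Complex.norm_natCast]
      calc (m / j : ℝ) * ‖l‖ ≤ m * ‖l‖ := by
            gcongr
            exact div_le_self hm0.le hj1'
        _ < m * (δ / (2 * m)) := by gcongr
        _ = δ / 2 := by field_simp
    have hq : (m / j : ℂ) * l + (∑ i, g i) / (j : ℂ) ∈ Metric.ball z₀ δ := by
      rw [Metric.mem_ball, dist_eq_norm] at hav ⊢
      calc _ = ‖(m / j : ℂ) * l + ((∑ i, g i) / (j : ℂ) - z₀)‖ := by rw [add_sub_assoc]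
        _ ≤ _ := norm_add_le _ _
        _ < δ := by linarith
    convert hscale j hj1 hjm _ hq using 1
    push_cast
    field_simp
  refine ⟨Real.exp s, Real.one_lt_exp_iff.2 hs, G, δ / (2 * m), by positivity,
    strictlyConvexArc_of_level hGa hquasi hGB hGs, hGnt, ?_, ?_, ?_⟩
  · intro z hz
    refine ⟨?_, ?_⟩
    · rw [mem_ofPred_eq, he.norm_eq z (hB z (hGB hz)).1, hGs z hz]
    · obtain ⟨-, ρ, -, hρ0, hρΓ, -⟩ := hnear z (hball (hGU hz))
      refine ⟨ρ⁻¹, inv_pos.2 hρ0, _, hρΓ, ?_⟩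
      have : (ρ : ℂ) ≠ 0 := by exact_mod_cast hρ0.ne'
      push_cast
      field_simp
  · rintro p ⟨hp, hpG⟩
    rw [union_singleton, convexHull_insert hGnt.nonempty, mem_convexJoin] at hp
    obtain ⟨_, rfl, b, hb, hpb⟩ := hp
    obtain ⟨a, t, ha, ht, hat, rfl⟩ := hpb
    have hpt : a • (0:ℂ) + t • b = (t:ℂ) * b := by simp
    rw [hpt] at hpG ⊢
    obtain ⟨hbB, hbs, hbG⟩ := re_le_and_mem_of_mem_convexHull (f := fun z => (e z).re)
      (convex_ball z₀ R) hquasi hGB hGs hb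
    have hbU := convexHull_min hGU (convex_ball z₀ (δ / 2)) hb
    obtain ⟨-, ρ, -, hρ0, hρΓ, hρB⟩ := hnear b (hball hbU)
    have hρc : (ρ : ℂ) ≠ 0 := by exact_mod_cast hρ0.ne'
    rcases le_or_gt t ρ with htρ | htρ
    · refine (hle _ ?_).trans_lt (Real.one_lt_exp_iff.2 hs)
      convert smul_mem_hull hρΓ (div_nonneg ht hρ0.le) ((div_le_one hρ0).2 htρ) using 1
      push_cast
      field_simp
    have hlt : ((t:ℂ) * b) ∈ Metric.ball z₀ R ∧ (e (t * b)).re < s := by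
      rcases eq_or_ne t 1 with rfl | ht1
      · simp only [Complex.ofReal_one, one_mul] at hpG ⊢
        exact ⟨hbB, lt_of_le_of_ne hbs fun h => hpG (hbG h)⟩
      have ht1' : t < 1 := lt_of_le_of_ne (by linarith) ht1
      have hb0 : b ≠ 0 := fun h => he0 (h ▸ (hB b hbB).1)
      have hne : (ρ : ℂ) * b ≠ b := fun h => by
        have : (ρ : ℂ) = 1 := mul_right_cancel₀ hb0 (by rw [h, one_mul])
        have : ρ = 1 := by exact_mod_cast this
        linarith
      have h1ρ : 0 < 1 - ρ := by linarith
      have hseg : (t:ℂ) * b ∈ openSegment ℝ ((ρ : ℂ) * b) b := by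
        refine ⟨(1 - t) / (1 - ρ), (t - ρ) / (1 - ρ), div_pos (by linarith) h1ρ,
          div_pos (by linarith) h1ρ, by field_simp; ring, ?_⟩
        have h1ρ' : (1 : ℂ) - ρ ≠ 0 := by exact_mod_cast h1ρ.ne'
        simp only [Complex.real_smul, Complex.ofReal_div, Complex.ofReal_sub, Complex.ofReal_one]
        field_simp
        ring
      refine ⟨(convex_ball z₀ R).openSegment_subset hρB hbB hseg, ?_⟩
      refine (hquasi _ hρB _ hbB hne _ hseg).trans_le (max_le ?_ hbs)
      rw [hre _ (hB _ hρB).1 hρΓ]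
      exact hs.le
    rw [mem_ofPred_eq, he.norm_eq _ (hB _ hlt.1).1]
    exact Real.exp_lt_exp.2 hlt.2
  · intro j hj1 hjm
    refine ⟨fun g hg => ?_, fun l hl g hg => hsum j hj1 hjm l hl.1.2 g hg⟩
    simpa using hsum j hj1 hjm 0 (by rw [norm_zero]; positivity) g hg
end
end

section
/- For each a ∈ ℂ with a ≠ 0, the operator cos(aD) on H(ℂ), given by (Tf)(z) = (f(z + ia) + f(z − ia))/2, supports a hypercyclic algebra: there exists an entire function f such that every nonzero element of the non-unital subalgebra generated by f (equivalently, every nonzero P(f) for a nonzero complex polynomial P with P(0) = 0) is hypercyclic for T. -/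
open Set Polynomial

noncomputable section

abbrev Entire : Type := {f : C(ℂ, ℂ) // Differentiable ℂ (⇑f)}

instance : Zero Entire := ⟨⟨0, by rw [ContinuousMap.coe_zero]; exact differentiable_const 0⟩⟩

def Hypercyclic {X : Type*} [TopologicalSpace X] (T : X → X) (x : X) : Prop :=
  Dense (Set.range fun n : ℕ => T^[n] x)

def polyApply (P : Polynomial ℂ) (f : Entire) : Entire :=
  ⟨⟨fun z => P.eval (f.1 z), by exact (P.differentiable.comp f.2).continuous⟩,
   by exact P.differentiable.comp f.2⟩

def GeneratesHCAlgebra (T : Entire → Entire) (f : Entire) : Prop :=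
  ∀ P : Polynomial ℂ, P.coeff 0 = 0 → polyApply P f ≠ 0 → Hypercyclic T (polyApply P f)

open Filter Topology

lemma strictConvexOn_log_cosh : StrictConvexOn ℝ univ fun x : ℝ => Real.log (Real.cosh x) := by
  have hd (x : ℝ) : HasDerivAt (fun x : ℝ => Real.log (Real.cosh x))
      (Real.sinh x / Real.cosh x) x :=
    (Real.hasDerivAt_cosh x).log (Real.cosh_pos x).ne'
  refine StrictMono.strictConvexOn_univ_of_deriv
    (Differentiable.continuous fun x => (hd x).differentiableAt) ?_
  rw [funext fun x => (hd x).deriv]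
  refine strictMono_of_deriv_pos fun x => ?_
  change 0 < deriv (Real.sinh / Real.cosh) x
  rw [((Real.hasDerivAt_sinh x).div (Real.hasDerivAt_cosh x) (Real.cosh_pos x).ne').deriv]
  have h := Real.cosh_sq x
  have := Real.cosh_pos x
  apply div_pos _ (by positivity)
  nlinarith

/-- The weight `cosh (N x) ^ (1 / N)`. -/
def coshWeight (N : ℕ) (x : ℝ) : ℝ := Real.exp (Real.log (Real.cosh (N * x)) / N)

lemma coshWeight_pos (N : ℕ) (x : ℝ) : 0 < coshWeight N x := Real.exp_pos _

lemma coshWeight_zero (N : ℕ) : coshWeight N 0 = 1 := by simp [coshWeight]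

lemma coshWeight_pow {N : ℕ} (hN : N ≠ 0) (x : ℝ) :
    coshWeight N x ^ N = Real.cosh (N * x) := by
  rw [coshWeight, ← Real.exp_nat_mul, mul_div_cancel₀ _ (by exact_mod_cast hN),
    Real.exp_log (Real.cosh_pos _)]

lemma one_lt_coshWeight {N : ℕ} (hN : N ≠ 0) {x : ℝ} (hx : x ≠ 0) : 1 < coshWeight N x := by
  have hN' : (0 : ℝ) < N := by positivity
  refine Real.one_lt_exp_iff.2 (div_pos (Real.log_pos (Real.one_lt_cosh.2 ?_)) hN')
  exact mul_ne_zero hN'.ne' hx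

lemma prod_coshWeight {κ : Type*} [Fintype κ] (N : ℕ) (x : κ → ℝ) :
    ∏ k, coshWeight N (x k) =
      Real.exp (∑ k, (1 / N : ℝ) • Real.log (Real.cosh (N * x k))) := by
  rw [Real.exp_sum]
  exact Finset.prod_congr rfl fun k _ => by rw [coshWeight, smul_eq_mul]; ring_nf

section Jensen

variable {κ : Type*} [Fintype κ] {N : ℕ}

lemma cosh_sum_le_of_card (hN : N ≠ 0) (hκ : Fintype.card κ = N) (x : κ → ℝ) :
    Real.cosh (∑ k, x k) ≤ ∏ k, coshWeight N (x k) := by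
  have hN' : (0 : ℝ) < N := by positivity
  rw [prod_coshWeight, ← Real.log_le_iff_le_exp (Real.cosh_pos _)]
  have h := strictConvexOn_log_cosh.convexOn.map_sum_le (t := Finset.univ)
    (w := fun _ : κ => (1 / N : ℝ)) (p := fun k => N * x k) (fun _ _ => by positivity)
    (by simp [hκ, hN'.ne']) (fun _ _ => mem_univ _)
  simpa [hN'.ne'] using h

lemma cosh_sum_lt_of_card (hN : N ≠ 0) (hκ : Fintype.card κ = N) (x : κ → ℝ)
    (hx : ∃ j k, x j ≠ x k) :
    Real.cosh (∑ k, x k) < ∏ k, coshWeight N (x k) := by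
  have hN' : (0 : ℝ) < N := by positivity
  obtain ⟨j, k, hjk⟩ := hx
  rw [prod_coshWeight, ← Real.log_lt_iff_lt_exp (Real.cosh_pos _)]
  have h := strictConvexOn_log_cosh.map_sum_lt (t := Finset.univ)
    (w := fun _ : κ => (1 / N : ℝ)) (p := fun k => N * x k) (fun _ _ => by positivity)
    (by simp [hκ, hN'.ne']) (fun _ _ => mem_univ _)
    ⟨j, Finset.mem_univ _, k, Finset.mem_univ _, by simpa [hN'.ne'] using hjk⟩
  simpa [hN'.ne'] using h

end Jensen

section Jensen

variable {m N : ℕ}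

lemma cosh_sum_le (hN : N ≠ 0) (hm : m ≤ N) (x : Fin m → ℝ) :
    Real.cosh (∑ k, x k) ≤ ∏ k, coshWeight N (x k) := by
  have h := cosh_sum_le_of_card hN (κ := Fin m ⊕ Fin (N - m)) (by simp; omega)
    (Sum.elim x 0)
  simpa [Fintype.sum_sum_type, Fintype.prod_sum_type, coshWeight_zero] using h

lemma cosh_sum_lt (hN : N ≠ 0) (hm0 : m ≠ 0) (hm : m ≤ N) (x : Fin m → ℝ)
    (hpos : ∀ k, 0 < x k) (hx : m = N → ∃ j k, x j ≠ x k) :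
    Real.cosh (∑ k, x k) < ∏ k, coshWeight N (x k) := by
  have h := cosh_sum_lt_of_card hN (κ := Fin m ⊕ Fin (N - m)) (by simp; omega)
    (Sum.elim x 0) ?_
  · simpa [Fintype.sum_sum_type, Fintype.prod_sum_type, coshWeight_zero] using h
  · rcases hm.lt_or_eq with h | h
    · exact ⟨.inl ⟨0, by omega⟩, .inr ⟨0, by omega⟩, (hpos _).ne'⟩
    · obtain ⟨j, k, hjk⟩ := hx h
      exact ⟨.inl j, .inl k, hjk⟩

end Jensen

lemma norm_cosh_sq (z : ℂ) :
    ‖Complex.cosh z‖ ^ 2 = Real.cosh z.re ^ 2 - Real.sin z.im ^ 2 := by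
  have h : Complex.cosh z = ⟨Real.cosh z.re * Real.cos z.im, Real.sinh z.re * Real.sin z.im⟩ := by
    conv_lhs => rw [← Complex.re_add_im z]
    rw [Complex.cosh_add, Complex.cosh_mul_I, Complex.sinh_mul_I]
    apply Complex.ext <;> simp [← Complex.ofReal_cosh, ← Complex.ofReal_sinh, ← Complex.ofReal_cos,
      ← Complex.ofReal_sin]
  rw [h, Complex.sq_norm, Complex.normSq_mk]
  have h1 := Real.cosh_sq z.re
  have h2 := Real.sin_sq_add_cos_sq z.im
  have h3 : Real.cos z.im ^ 2 = 1 - Real.sin z.im ^ 2 := by linarith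
  linear_combination (Real.sin z.im ^ 2) * (-h1) + Real.cosh z.re ^ 2 * h3

lemma norm_cosh_le (z : ℂ) : ‖Complex.cosh z‖ ≤ Real.cosh z.re := by
  refine le_of_sq_le_sq ?_ (Real.cosh_pos _).le
  rw [norm_cosh_sq]
  nlinarith [sq_nonneg (Real.sin z.im)]

lemma norm_cosh_lt {z : ℂ} (h0 : 0 < z.im) (h1 : z.im < Real.pi) :
    ‖Complex.cosh z‖ < Real.cosh z.re := by
  refine lt_of_pow_lt_pow_left₀ 2 (Real.cosh_pos _).le ?_
  rw [norm_cosh_sq]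
  nlinarith [pow_pos (Real.sin_pos_of_pos_of_lt_pi h0 h1) 2]

/-- Exponents used for the degree `N`: a short vertical segment and the positive half-line. -/
def IsAdmissible (N : ℕ) (z : ℂ) : Prop :=
  (z.re = 0 ∧ 0 < z.im ∧ z.im < Real.pi / N) ∨ (z.im = 0 ∧ 0 < z.re)

lemma norm_cosh_sum_lt_or {m N : ℕ} (hm0 : m ≠ 0) (hm : m ≤ N) (φ : Fin m → ℂ)
    (hφ : ∀ k, IsAdmissible N (φ k)) :
    ‖Complex.cosh (∑ k, φ k)‖ < ∏ k, coshWeight N (φ k).re ∨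
      m = N ∧ ∃ x : ℝ, 0 < x ∧ ∀ k, φ k = x := by
  have hN : N ≠ 0 := by omega
  have hN' : (0 : ℝ) < N := by positivity
  have him (k : Fin m) : 0 ≤ (φ k).im ∧ (φ k).im < Real.pi / N := by
    rcases hφ k with h | h
    · exact ⟨h.2.1.le, h.2.2⟩
    · rw [h.1]; exact ⟨le_rfl, by positivity⟩
  by_cases hex : ∃ k, 0 < (φ k).im
  · left
    obtain ⟨k, hk⟩ := hex
    calc _ < Real.cosh (∑ k, φ k).re := norm_cosh_lt ?_ ?_
      _ ≤ _ := by rw [Complex.re_sum]; exact cosh_sum_le hN hm _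
    · rw [Complex.im_sum]
      exact Finset.sum_pos' (fun k _ => (him k).1) ⟨k, Finset.mem_univ _, hk⟩
    · rw [Complex.im_sum]
      calc _ < ∑ k : Fin m, Real.pi / N :=
            Finset.sum_lt_sum_of_nonempty ⟨k, Finset.mem_univ _⟩ fun k _ => (him k).2
        _ = m * (Real.pi / N) := by simp
        _ ≤ N * (Real.pi / N) := by gcongr
        _ = Real.pi := by field_simp
  · push Not at hex
    have hre (k : Fin m) : (φ k).im = 0 ∧ 0 < (φ k).re := by
      rcases hφ k with h | h
      · exact absurd h.2.1 (hex k).not_gt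
      · exact h
    by_cases hc : m = N ∧ ∀ j k, (φ j).re = (φ k).re
    · refine .inr ⟨hc.1, (φ ⟨0, by omega⟩).re, (hre _).2, fun k => ?_⟩
      exact Complex.ext (hc.2 _ _) (hre k).1
    · left
      refine (norm_cosh_le _).trans_lt ?_
      rw [Complex.re_sum]
      refine cosh_sum_lt hN hm0 hm _ (fun k => (hre k).2) fun h => ?_
      by_contra! hall
      exact hc ⟨h, hall⟩

/-- The exponential `z ↦ exp (μ z / b)`. -/
def expMap (b μ : ℂ) : C(ℂ, ℂ) := ⟨fun z => Complex.exp (μ * z / b), by fun_prop⟩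

lemma expMap_apply (b μ z : ℂ) : expMap b μ z = Complex.exp (μ * z / b) := rfl

lemma differentiable_expMap (b μ : ℂ) : Differentiable ℂ (expMap b μ) := by
  change Differentiable ℂ fun z => Complex.exp (μ * z / b)
  fun_prop

lemma expMap_sum {κ : Type*} (s : Finset κ) (b : ℂ) (μ : κ → ℂ) :
    expMap b (∑ k ∈ s, μ k) = ∏ k ∈ s, expMap b (μ k) := by
  ext z
  simp [expMap_apply, ContinuousMap.prod_apply, ← Complex.exp_sum, Finset.sum_mul, Finset.sum_div]

lemma expMap_pow (b μ : ℂ) (n : ℕ) : expMap b μ ^ n = expMap b (n * μ) := by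
  ext z
  rw [ContinuousMap.pow_apply, expMap_apply, expMap_apply, ← Complex.exp_nat_mul]
  ring_nf

lemma expMap_mul_sub_one_pow_mem_span {b w : ℂ} {δ h : ℝ} (k : ℕ) (hh : 0 < h)
    (hδ : (k + 1) * h < δ) :
    expMap b (h * w) * (expMap b (h * w) - 1) ^ k ∈
      Submodule.span ℂ (expMap b '' {μ | ∃ t : ℝ, 0 < t ∧ t < δ ∧ μ = t * w}) := by
  rw [sub_eq_add_neg, add_pow, Finset.mul_sum]
  refine Submodule.sum_mem _ fun j hj => ?_
  have hjk : j ≤ k := by simpa [Nat.lt_succ_iff] using hj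
  have e : expMap b (h * w) * (expMap b (h * w) ^ j * (-1) ^ (k - j) * (k.choose j : C(ℂ, ℂ))) =
      ((-1) ^ (k - j) * (k.choose j : ℂ)) • expMap b (((j + 1) * h : ℝ) * w) := by
    have : expMap b (((j + 1) * h : ℝ) * w) = expMap b (h * w) ^ (j + 1) := by
      rw [expMap_pow]; congr 1; push_cast; ring
    rw [this]
    ext z
    simp
    ring
  rw [e]
  refine Submodule.smul_mem _ _ (Submodule.subset_span ⟨_, ⟨(j + 1) * h, by positivity, ?_, rfl⟩, rfl⟩)
  refine lt_of_le_of_lt ?_ hδ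
  gcongr

lemma continuous_dslope_exp : Continuous (dslope Complex.exp 0) := by
  rw [← continuousOn_univ, continuousOn_dslope univ_mem]
  exact ⟨Complex.continuous_exp.continuousOn, Complex.differentiable_exp _⟩

lemma pow_mem_closure_span_expMap {b w : ℂ} (hb : b ≠ 0) (hw : w ≠ 0) {δ : ℝ} (hδ : 0 < δ)
    (k : ℕ) :
    (ContinuousMap.id ℂ) ^ k ∈ (Submodule.span ℂ
      (expMap b '' {μ | ∃ t : ℝ, 0 < t ∧ t < δ ∧ μ = t * w})).topologicalClosure := by
  have hcont := continuous_dslope_exp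
  let G : C(ℝ × ℂ, ℂ) := ⟨fun p => Complex.exp (p.1 * w * p.2 / b) *
    (p.2 * dslope Complex.exp 0 (p.1 * w * p.2 / b)) ^ k, by fun_prop⟩
  have hG0 : G.curry 0 = (ContinuousMap.id ℂ) ^ k := by
    ext z
    simp [G]
  have hlim : Tendsto (fun h => G.curry h) (𝓝[>] 0) (𝓝 ((ContinuousMap.id ℂ) ^ k)) := by
    rw [← hG0]
    exact (G.curry.continuous.tendsto 0).mono_left nhdsWithin_le_nhds
  refine mem_closure_of_tendsto hlim ?_
  have hpos : 0 < δ / (k + 1) := by positivity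
  filter_upwards [Ioo_mem_nhdsGT hpos] with h hh
  have hh0 : (h : ℂ) ≠ 0 := by exact_mod_cast hh.1.ne'
  have e : G.curry h = ((h * w / b) ^ k)⁻¹ • (expMap b (h * w) * (expMap b (h * w) - 1) ^ k) := by
    ext z
    have hs := sub_smul_dslope Complex.exp 0 (h * w * z / b)
    rw [sub_zero, Complex.exp_zero, smul_eq_mul] at hs
    simp only [G, ContinuousMap.curry_apply, ContinuousMap.coe_mk, ContinuousMap.smul_apply,
      ContinuousMap.mul_apply, ContinuousMap.pow_apply, ContinuousMap.sub_apply,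
      ContinuousMap.one_apply, expMap_apply, smul_eq_mul, ← hs]
    field_simp
    rw [← mul_pow]
    congr 1
    field_simp
  rw [e]
  refine Submodule.smul_mem _ _ (expMap_mul_sub_one_pow_mem_span k hh.1 ?_)
  have := (lt_div_iff₀ (by positivity)).1 hh.2
  linarith

lemma mem_closure_span_expMap {b w : ℂ} (hb : b ≠ 0) (hw : w ≠ 0) {δ : ℝ} (hδ : 0 < δ)
    {f : C(ℂ, ℂ)} (hf : Differentiable ℂ f) :
    f ∈ (Submodule.span ℂ
      (expMap b '' {μ | ∃ t : ℝ, 0 < t ∧ t < δ ∧ μ = t * w})).topologicalClosure := by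
  let p := cauchyPowerSeries f 0 (1 : NNReal)
  have hp : HasFPowerSeriesOnBall f p 0 ⊤ := hf.hasFPowerSeriesOnBall 0 one_pos
  let F : ℕ → C(ℂ, ℂ) := fun n => ∑ k ∈ Finset.range n, p.coeff k • (ContinuousMap.id ℂ) ^ k
  have hF : Tendsto F atTop (𝓝 f) := by
    rw [ContinuousMap.tendsto_iff_tendstoLocallyUniformly, ← tendstoLocallyUniformlyOn_univ]
    have h := hp.tendstoLocallyUniformlyOn
    rw [Metric.eball_top] at h
    simp only [zero_add] at h
    refine h.congr fun n z _ => ?_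
    simp [F, FormalMultilinearSeries.partialSum, ContinuousMap.sum_apply, mul_comm]
  refine (Submodule.isClosed_topologicalClosure _).mem_of_tendsto hF (.of_forall fun n => ?_)
  exact Submodule.sum_mem _ fun k _ =>
    Submodule.smul_mem _ _ (pow_mem_closure_span_expMap hb hw hδ k)

/-- The operator `f ↦ (f(· + b) + f(· - b)) / 2` on continuous functions. -/
def shiftMean (b : ℂ) : C(ℂ, ℂ) →L[ℂ] C(ℂ, ℂ) where
  toLinearMap := (2⁻¹ : ℂ) • ((ContinuousMap.compRightAlgHom ℂ ℂ
      (ContinuousMap.id ℂ + ContinuousMap.const ℂ b)).toLinearMap +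
    (ContinuousMap.compRightAlgHom ℂ ℂ (ContinuousMap.id ℂ - ContinuousMap.const ℂ b)).toLinearMap)
  cont := ((ContinuousMap.compRightAlgHom_continuous ℂ ℂ _).add
    (ContinuousMap.compRightAlgHom_continuous ℂ ℂ _)).const_smul _

lemma shiftMean_apply (b : ℂ) (f : C(ℂ, ℂ)) (z : ℂ) :
    shiftMean b f z = (f (z + b) + f (z - b)) / 2 := by
  rw [div_eq_inv_mul]
  rfl

lemma shiftMean_expMap {b : ℂ} (hb : b ≠ 0) (μ : ℂ) :
    shiftMean b (expMap b μ) = Complex.cosh μ • expMap b μ := by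
  ext z
  rw [shiftMean_apply, ContinuousMap.smul_apply, smul_eq_mul, Complex.cosh, expMap_apply,
    expMap_apply, expMap_apply]
  have h1 : μ * (z + b) / b = μ + μ * z / b := by field_simp; ring
  have h2 : μ * (z - b) / b = -μ + μ * z / b := by field_simp; ring
  rw [h1, h2, Complex.exp_add, Complex.exp_add]
  ring

lemma shiftMean_pow_expMap {b : ℂ} (hb : b ≠ 0) (μ : ℂ) (n : ℕ) :
    (shiftMean b ^ n) (expMap b μ) = Complex.cosh μ ^ n • expMap b μ := by
  induction n with
  | zero => simp
  | succ n ih => rw [pow_succ', mul_apply_eq_comp, ih, map_smul, shiftMean_expMap hb,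
      smul_smul, pow_succ]

lemma tendsto_smul_expMap_of_norm_cosh_lt {ι : Type*} {b : ℂ} {N : ℕ} {lam d : ι → ℂ} {m : ℕ} (φ : Fin m → ι)
    (h : ‖Complex.cosh (∑ k, lam (φ k))‖ < ∏ k, coshWeight N (lam (φ k)).re) :
    Tendsto (fun n => ((∏ k, d (φ k)) * (Complex.cosh (∑ k, lam (φ k)) /
        ∏ k, (coshWeight N (lam (φ k)).re : ℂ)) ^ n) • expMap b (∑ k, lam (φ k)))
      atTop (𝓝 0) := by
  have hp : 0 < ∏ k, coshWeight N (lam (φ k)).re := Finset.prod_pos fun _ _ => coshWeight_pos _ _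
  have h1 : ‖Complex.cosh (∑ k, lam (φ k)) / ∏ k, (coshWeight N (lam (φ k)).re : ℂ)‖ < 1 := by
    rw [norm_div, ← Complex.ofReal_prod, Complex.norm_real, Real.norm_of_nonneg hp.le,
      div_lt_one hp]
    exact h
  have h2 := ((tendsto_pow_atTop_nhds_zero_of_norm_lt_one h1).const_mul (∏ k, d (φ k))).smul_const
    (expMap b (∑ k, lam (φ k)))
  rwa [mul_zero, show (0 : ℂ) • expMap b (∑ k, lam (φ k)) = 0 from by ext; simp] at h2

section Limits

variable {ι : Type*} [Fintype ι] {b : ℂ} {N : ℕ} {lam : ι → ℂ} {d : ι → ℂ}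

/-- The exponential polynomial `∑ dᵢ exp (lamᵢ z / b)` with coefficients damped by the `n`-th powers
of the weights. -/
def dampedSum (b : ℂ) (N : ℕ) (lam d : ι → ℂ) (n : ℕ) : C(ℂ, ℂ) :=
  ∑ i, (d i / (coshWeight N (lam i).re : ℂ) ^ n) • expMap b (lam i)

lemma differentiable_dampedSum (n : ℕ) : Differentiable ℂ (dampedSum b N lam d n) := by
  have : ⇑(dampedSum b N lam d n) =
      fun z => ∑ i, (d i / (coshWeight N (lam i).re : ℂ) ^ n) * expMap b (lam i) z := by
    ext z; simp [dampedSum, ContinuousMap.sum_apply]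
  rw [this]
  have := differentiable_expMap b
  fun_prop

lemma shiftMean_pow_dampedSum_pow (hb : b ≠ 0) (m n : ℕ) :
    (shiftMean b ^ n) (dampedSum b N lam d n ^ m) =
      ∑ φ : Fin m → ι, ((∏ k, d (φ k)) * (Complex.cosh (∑ k, lam (φ k)) /
        ∏ k, (coshWeight N (lam (φ k)).re : ℂ)) ^ n) • expMap b (∑ k, lam (φ k)) := by
  rw [dampedSum, Fintype.sum_pow, map_sum]
  refine Finset.sum_congr rfl fun φ _ => ?_
  rw [Finset.prod_smul, ← expMap_sum, map_smul, shiftMean_pow_expMap hb, smul_smul,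
    Finset.prod_div_distrib, Finset.prod_pow, div_pow]
  congr 1
  ring

lemma tendsto_dampedSum (hN : N ≠ 0) (hlam : ∀ i, IsAdmissible N (lam i)) :
    Tendsto (dampedSum b N lam d) atTop
      (𝓝 (∑ i, if (lam i).im = 0 then 0 else d i • expMap b (lam i))) := by
  refine tendsto_finsetSum _ fun i _ => ?_
  rcases hlam i with ⟨h, h', -⟩ | ⟨h, h'⟩
  · simp [h, h'.ne', coshWeight_zero]
  · have h1 : ‖((coshWeight N (lam i).re : ℂ))⁻¹‖ < 1 := by
      rw [norm_inv, Complex.norm_real, Real.norm_of_nonneg (coshWeight_pos _ _).le]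
      exact inv_lt_one_of_one_lt₀ (one_lt_coshWeight hN h'.ne')
    have h2 := ((tendsto_pow_atTop_nhds_zero_of_norm_lt_one h1).const_mul (d i)).smul_const
      (expMap b (lam i))
    rw [mul_zero, show (0 : ℂ) • expMap b (lam i) = 0 from by ext; simp] at h2
    simpa [h, div_eq_mul_inv] using h2

lemma tendsto_shiftMean_pow_of_lt (hb : b ≠ 0) (hlam : ∀ i, IsAdmissible N (lam i)) {m : ℕ}
    (hm0 : m ≠ 0) (hm : m < N) :
    Tendsto (fun n => (shiftMean b ^ n) (dampedSum b N lam d n ^ m)) atTop (𝓝 0) := by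
  simp_rw [shiftMean_pow_dampedSum_pow hb]
  rw [← Finset.sum_const_zero (s := (Finset.univ : Finset (Fin m → ι)))]
  refine tendsto_finsetSum _ fun φ _ => tendsto_smul_expMap_of_norm_cosh_lt φ ?_
  exact (norm_cosh_sum_lt_or hm0 hm.le _ fun k => hlam (φ k)).resolve_right fun h => hm.ne h.1

lemma tendsto_shiftMean_pow_self (hb : b ≠ 0) (hN : N ≠ 0) (hinj : Function.Injective lam)
    (hlam : ∀ i, IsAdmissible N (lam i)) :
    Tendsto (fun n => (shiftMean b ^ n) (dampedSum b N lam d n ^ N)) atTop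
      (𝓝 (∑ i, if (lam i).im = 0 then d i ^ N • expMap b (N * lam i) else 0)) := by
  classical
  have : NeZero N := ⟨hN⟩
  simp_rw [shiftMean_pow_dampedSum_pow hb]
  rw [Fintype.sum_of_injective (fun (i : ι) (_ : Fin N) => i)
    (fun i j h => congrFun h 0) _ (fun φ => if ∃ i, (lam i).im = 0 ∧ φ = fun _ => i then
      (∏ k, d (φ k)) • expMap b (∑ k, lam (φ k)) else 0)]
  · refine tendsto_finsetSum _ fun φ _ => ?_
    split_ifs with h
    · obtain ⟨i, hi, rfl⟩ := h
      have hre : lam i = ((lam i).re : ℂ) := Complex.ext rfl hi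
      have h1 : Complex.cosh (∑ _k : Fin N, lam i) /
          ∏ _k : Fin N, (coshWeight N (lam i).re : ℂ) = 1 := by
        rw [Finset.prod_const, Finset.sum_const, Finset.card_univ, Fintype.card_fin,
          ← Complex.ofReal_pow, coshWeight_pow hN, nsmul_eq_mul, Complex.ofReal_cosh,
          Complex.ofReal_mul, Complex.ofReal_natCast, ← hre, div_self]
        rw [hre, ← Complex.ofReal_natCast, ← Complex.ofReal_mul, ← Complex.ofReal_cosh]
        exact_mod_cast (Real.cosh_pos _).ne'
      simp only [h1, one_pow, mul_one]
      exact tendsto_const_nhds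
    · refine tendsto_smul_expMap_of_norm_cosh_lt φ ?_
      refine (norm_cosh_sum_lt_or hN le_rfl _ fun k => hlam (φ k)).resolve_right ?_
      rintro ⟨-, x, -, hx⟩
      refine h ⟨φ 0, by simp [hx 0], funext fun k => hinj ?_⟩
      rw [hx, hx]
  · intro φ hφ
    rw [if_neg]
    rintro ⟨i, -, rfl⟩
    exact hφ ⟨i, rfl⟩
  · intro i
    have : (∃ j, (lam j).im = 0 ∧ (fun _ : Fin N => i) = fun _ => j) ↔ (lam i).im = 0 :=
      ⟨fun ⟨j, hj, h⟩ => by rw [show i = j from congrFun h 0]; exact hj, fun h => ⟨i, h, rfl⟩⟩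
    simp [this]

end Limits

lemma exists_orbit_mem {b : ℂ} (hb : b ≠ 0) (p : ℕ) {f g : C(ℂ, ℂ)} (hf : Differentiable ℂ f)
    (hg : Differentiable ℂ g) {O : Set C(ℂ, ℂ)} (hO : O ∈ 𝓝 f) {G : Set (Fin (p + 1) → C(ℂ, ℂ))}
    (hG : G ∈ 𝓝 (Pi.single (Fin.last p) g)) :
    ∃ u : C(ℂ, ℂ), Differentiable ℂ u ∧ u ∈ O ∧
      ∃ n : ℕ, (fun i : Fin (p + 1) => (shiftMean b ^ n) (u ^ (i.1 + 1))) ∈ G := by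
  classical
  have hδ : 0 < Real.pi / (p + 1 : ℕ) := by positivity
  obtain ⟨f', hf'O, hf'⟩ := mem_closure_iff_nhds.1
    (mem_closure_span_expMap hb Complex.I_ne_zero hδ hf) _ (interior_mem_nhds.2 hO)
  obtain ⟨g', hg'G, hg'⟩ := mem_closure_iff_nhds.1
    (mem_closure_span_expMap hb one_ne_zero one_pos hg) _
    ((continuous_single (A := fun _ => C(ℂ, ℂ)) (Fin.last p)).continuousAt.preimage_mem_nhds
      (interior_mem_nhds.2 hG))
  obtain ⟨t₁, ht₁, c₁, rfl⟩ := Submodule.mem_span_image_iff_exists_fun ℂ |>.1 hf'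
  obtain ⟨t₂, ht₂, c₂, rfl⟩ := Submodule.mem_span_image_iff_exists_fun ℂ |>.1 hg'
  choose r hr using fun j => IsAlgClosed.exists_pow_nat_eq (c₂ j) p.succ_pos
  have hp : ((p + 1 : ℕ) : ℂ) ≠ 0 := by exact_mod_cast p.succ_ne_zero
  let lam : t₁ ⊕ t₂ → ℂ := Sum.elim (fun i => i) (fun j => j / (p + 1 : ℕ))
  let d : t₁ ⊕ t₂ → ℂ := Sum.elim c₁ r
  have h₁ (i : t₁) : (i : ℂ).re = 0 ∧ 0 < (i : ℂ).im ∧ (i : ℂ).im < Real.pi / (p + 1 : ℕ) := by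
    obtain ⟨t, h0, h1, h⟩ := ht₁ i.2
    simpa [h, h0] using h1
  have h₂ (j : t₂) : ((j : ℂ) / (p + 1 : ℕ)).im = 0 ∧ 0 < ((j : ℂ) / (p + 1 : ℕ)).re := by
    obtain ⟨t, h0, h1, h⟩ := ht₂ j.2
    rw [mul_one] at h
    rw [h, Complex.div_natCast_im, Complex.div_natCast_re]
    simp only [Complex.ofReal_im, Complex.ofReal_re, zero_div, true_and]
    positivity
  have hlam : ∀ i, IsAdmissible (p + 1) (lam i) := by
    rintro (i | j)
    · exact .inl (h₁ i)
    · exact .inr (h₂ j)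
  have hinj : Function.Injective lam := by
    rintro (i | i) (j | j) h
    · exact congrArg Sum.inl (Subtype.ext h)
    · exact absurd ((congrArg Complex.im h).trans (h₂ j).1) (h₁ i).2.1.ne'
    · exact absurd ((congrArg Complex.im h).symm.trans (h₂ i).1) (h₁ j).2.1.ne'
    · exact congrArg Sum.inr (Subtype.ext ((div_left_inj' hp).1 h))
  have hu := tendsto_dampedSum (b := b) (d := d) p.succ_ne_zero hlam
  have hself := tendsto_shiftMean_pow_self (d := d) hb p.succ_ne_zero hinj hlam
  have hl (i : t₁) : ¬ (lam (.inl i)).im = 0 := (h₁ i).2.1.ne'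
  have hr' (j : t₂) : (lam (.inr j)).im = 0 := (h₂ j).1
  have hm (j : t₂) : ((p + 1 : ℕ) : ℂ) * lam (.inr j) = j := mul_div_cancel₀ _ hp
  simp only [Fintype.sum_sum_type, hl, hr', if_true, if_false, Finset.sum_const_zero, add_zero,
    zero_add, hm] at hu hself
  have htup : Tendsto (fun n => fun i : Fin (p + 1) =>
      (shiftMean b ^ n) (dampedSum b (p + 1) lam d n ^ (i.1 + 1))) atTop
      (𝓝 (Pi.single (Fin.last p) (∑ j, c₂ j • expMap b j))) := by
    refine tendsto_pi_nhds.2 fun i => ?_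
    by_cases hi : i = Fin.last p
    · subst hi
      rw [Pi.single_eq_same]
      simpa [d, hr] using hself
    · rw [Pi.single_eq_of_ne hi]
      exact tendsto_shiftMean_pow_of_lt hb hlam i.1.succ_ne_zero
        (Nat.succ_lt_succ (Fin.lt_last_iff_ne_last.2 hi))
  have e₁ := hu.eventually (isOpen_interior.mem_nhds hf'O)
  have e₂ := htup.eventually (isOpen_interior.mem_nhds hg'G)
  obtain ⟨n, hn₁, hn₂⟩ := (e₁.and e₂).exists
  exact ⟨_, differentiable_dampedSum n, interior_subset hn₁, n, interior_subset hn₂⟩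

lemma isClosed_entire : IsClosed {f : C(ℂ, ℂ) | Differentiable ℂ f} := by
  refine isClosed_of_closure_subset fun f hf => ?_
  obtain ⟨u, hu, hlim⟩ := mem_closure_iff_seq_limit.1 hf
  rw [ContinuousMap.tendsto_iff_tendstoLocallyUniformly, ← tendstoLocallyUniformlyOn_univ] at hlim
  exact differentiableOn_univ.1
    (hlim.differentiableOn (.of_forall fun n => (hu n).differentiableOn) isOpen_univ)

instance : BaireSpace Entire :=
  have : TopologicalSpace.IsCompletelyPseudoMetrizableSpace Entire :=
    isClosed_entire.isCompletelyPseudoMetrizableSpace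
  inferInstance

/-- The powers `f, …, f ^ (p + 1)` have a common iterate under `shiftMean b` lying in `G`. -/
def orbitSet (b : ℂ) (p : ℕ) (G : Set (Fin (p + 1) → C(ℂ, ℂ))) : Set Entire :=
  {f | ∃ n : ℕ, (fun i : Fin (p + 1) => (shiftMean b ^ n) (f.1 ^ (i.1 + 1))) ∈ G}

lemma isOpen_orbitSet (b : ℂ) (p : ℕ) {G : Set (Fin (p + 1) → C(ℂ, ℂ))} (hG : IsOpen G) :
    IsOpen (orbitSet b p G) := by
  simp only [orbitSet, ofPred_exists]
  exact isOpen_iUnion fun n => hG.preimage (by fun_prop)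

lemma dense_orbitSet {b : ℂ} (hb : b ≠ 0) (p : ℕ) {G : Set (Fin (p + 1) → C(ℂ, ℂ))}
    {g : C(ℂ, ℂ)} (hg : Differentiable ℂ g) (hG : G ∈ 𝓝 (Pi.single (Fin.last p) g)) :
    Dense (orbitSet b p G) := by
  intro f
  rw [mem_closure_iff_nhds]
  intro t ht
  obtain ⟨O, hO, hOt⟩ := mem_nhds_subtype _ _ _ |>.1 ht
  obtain ⟨u, hu, huO, hn⟩ := exists_orbit_mem hb p f.2 hg hO hG
  exact ⟨⟨u, hu⟩, hOt huO, hn⟩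

/-- A Baire-generic entire function has, for every `p` and every entire `g`, iterates sending
`(f, …, f ^ p, f ^ (p + 1))` close to `(0, …, 0, g)`. -/
lemma exists_forall_mem_orbitSet {b : ℂ} (hb : b ≠ 0) :
    ∃ f : Entire, ∀ (p : ℕ) (g : C(ℂ, ℂ)), Differentiable ℂ g →
      ∀ G ∈ 𝓝 (Pi.single (Fin.last p) g), f ∈ orbitSet b p G := by
  let B (p : ℕ) := TopologicalSpace.countableBasis (Fin (p + 1) → C(ℂ, ℂ))
  let S : Set (Set Entire) := ⋃ p, orbitSet b p '' {G ∈ B p | Dense (orbitSet b p G)}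
  have hS : S.Countable := countable_iUnion fun p =>
    ((TopologicalSpace.countable_countableBasis _).mono (sep_subset _ _)).image _
  have hd : Dense (⋂₀ S) := by
    refine dense_sInter_of_isOpen ?_ hS ?_
    · rintro s hs
      obtain ⟨p, G, hG, rfl⟩ := mem_iUnion.1 hs
      exact isOpen_orbitSet b p (TopologicalSpace.isOpen_of_mem_countableBasis hG.1)
    · rintro s hs
      obtain ⟨p, G, hG, rfl⟩ := mem_iUnion.1 hs
      exact hG.2
  have : Nonempty Entire := ⟨0⟩
  obtain ⟨f, hf⟩ := hd.nonempty
  refine ⟨f, fun p g hg G hG => ?_⟩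
  obtain ⟨G', hG', hgG', hsub⟩ :=
    (TopologicalSpace.isBasis_countableBasis _).mem_nhds_iff.1 hG
  obtain ⟨n, hn⟩ := hf (orbitSet b p G') (mem_iUnion.2 ⟨p, G', ⟨hG', dense_orbitSet hb p hg
    ((TopologicalSpace.isOpen_of_mem_countableBasis hG').mem_nhds hgG')⟩, rfl⟩)
  exact ⟨n, hsub hn⟩

lemma polyApply_coe_eq_sum {P : Polynomial ℂ} (hP : P.coeff 0 = 0) {p : ℕ}
    (hp : P.natDegree = p + 1) (f : Entire) :
    (polyApply P f).1 = ∑ i : Fin (p + 1), P.coeff (i.1 + 1) • f.1 ^ (i.1 + 1) := by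
  ext z
  have : (polyApply P f).1 z = P.eval (f.1 z) := rfl
  rw [this, eval_eq_sum_range, hp, Finset.sum_range_succ', hP, Finset.sum_range]
  simp [ContinuousMap.sum_apply]

/-- For `a ≠ 0`, the operator `cos(aD)`, given by
`(Tf)(z) = (f(z + ia) + f(z − ia))/2`, supports a hypercyclic algebra on `H(ℂ)`. -/
theorem stmt6 (a : ℂ) (ha : a ≠ 0) (T : Entire → Entire)
    (hT : ∀ (f : Entire) (z : ℂ),
      (T f).1 z = (f.1 (z + Complex.I * a) + f.1 (z - Complex.I * a)) / 2) :
    ∃ f : Entire, f ≠ 0 ∧ GeneratesHCAlgebra T f := by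
  have hb : Complex.I * a ≠ 0 := mul_ne_zero Complex.I_ne_zero ha
  have hTL (f : Entire) : (T f).1 = shiftMean (Complex.I * a) f.1 :=
    ContinuousMap.ext fun z => (hT f z).trans (shiftMean_apply _ _ _).symm
  have hTn (n : ℕ) (f : Entire) : (T^[n] f).1 = (shiftMean (Complex.I * a) ^ n) f.1 := by
    induction n with
    | zero => rfl
    | succ n ih => rw [Function.iterate_succ_apply', hTL, ih, pow_succ', mul_apply_eq_comp]
  obtain ⟨f, hf⟩ := exists_forall_mem_orbitSet hb
  refine ⟨f, ?_, fun P hP hPf => ?_⟩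
  · rintro rfl
    obtain ⟨n, hn⟩ := hf 0 1 (differentiable_const 1) {w | w 0 ≠ 0}
      ((isOpen_ne.preimage (continuous_apply 0)).mem_nhds (by simp [Fin.last]))
    refine hn ?_
    change (shiftMean (Complex.I * a) ^ n) ((0 : C(ℂ, ℂ)) ^ (0 + 1)) = 0
    rw [zero_add, pow_one, map_zero]
  · obtain ⟨p, hp⟩ : ∃ p, P.natDegree = p + 1 := by
      refine Nat.exists_eq_succ_of_ne_zero fun h => hPf (Subtype.ext (ContinuousMap.ext fun z => ?_))
      change P.eval (f.1 z) = 0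
      rw [eq_C_of_natDegree_eq_zero h, hP, C_0, eval_zero]
    have hc : P.coeff (p + 1) ≠ 0 := by
      rw [← hp]
      refine leadingCoeff_ne_zero.2 ?_
      rintro rfl
      simp at hp
    intro g
    rw [mem_closure_iff_nhds]
    intro t ht
    obtain ⟨O, hO, hOt⟩ := mem_nhds_subtype _ _ _ |>.1 ht
    let ψ : (Fin (p + 1) → C(ℂ, ℂ)) → C(ℂ, ℂ) := fun w => ∑ i, P.coeff (i.1 + 1) • w i
    have hψ : Continuous ψ := by fun_prop
    have hψg : ψ (Pi.single (Fin.last p) ((P.coeff (p + 1))⁻¹ • g.1)) = g.1 := by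
      simp only [ψ]
      rw [Finset.sum_eq_single_of_mem (Fin.last p) (Finset.mem_univ _)
        (fun i _ hi => by rw [Pi.single_eq_of_ne hi]; ext; simp), Pi.single_eq_same, Fin.val_last,
        smul_inv_smul₀ hc]
    obtain ⟨n, hn⟩ := hf p ((P.coeff (p + 1))⁻¹ • g.1) (g.2.const_smul _) (ψ ⁻¹' O)
      (hψ.continuousAt.preimage_mem_nhds (by rwa [hψg]))
    refine ⟨_, hOt ?_, n, rfl⟩
    change (T^[n] (polyApply P f)).1 ∈ O
    rw [hTn, polyApply_coe_eq_sum hP hp, map_sum]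
    simp_rw [map_smul]
    exact hn
end
end

section
/- The operator De^D = D∘τ₁ on H(ℂ), given by (Tf)(z) = f′(z + 1), supports a hypercyclic algebra: there exists an entire function f such that every nonzero element of the non-unital subalgebra generated by f (equivalently, every nonzero P(f) for a nonzero complex polynomial P with P(0) = 0) is hypercyclic for T. -/
open Set Polynomial

noncomputable section

open Filter Topology

namespace Entire

/-! ### The topology of `H(ℂ)` -/

lemma isClosed_setOf_differentiable : IsClosed {f : C(ℂ, ℂ) | Differentiable ℂ (⇑f)} := by
  rw [isClosed_iff_clusterPt]
  intro f hf
  have : (𝓝 f ⊓ 𝓟 {f : C(ℂ, ℂ) | Differentiable ℂ (⇑f)}).NeBot := hf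
  have h : Tendsto (fun g : C(ℂ, ℂ) => g) (𝓝 f ⊓ 𝓟 {f : C(ℂ, ℂ) | Differentiable ℂ (⇑f)}) (𝓝 f) :=
    inf_le_left
  rw [ContinuousMap.tendsto_iff_tendstoLocallyUniformly, ← tendstoLocallyUniformlyOn_univ] at h
  have hd := h.differentiableOn (U := univ)
    (eventually_inf_principal.2 (Eventually.of_forall fun g hg => hg.differentiableOn)) isOpen_univ
  exact differentiableOn_univ.1 hd

instance : BaireSpace Entire := by
  have : TopologicalSpace.IsCompletelyPseudoMetrizableSpace Entire :=
    isClosed_setOf_differentiable.isCompletelyPseudoMetrizableSpace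
  infer_instance

lemma exists_polynomial_mem {U : Set C(ℂ, ℂ)} (hU : IsOpen U) {f : C(ℂ, ℂ)}
    (hf : Differentiable ℂ f) (hfU : f ∈ U) :
    ∃ p : ℂ[X], (⟨fun z => p.eval z, p.continuous⟩ : C(ℂ, ℂ)) ∈ U := by
  have hs := hf.hasFPowerSeriesOnBall 0 (R := 1) one_pos
  set q := cauchyPowerSeries f 0 ((1 : NNReal) : ℝ)
  let P : ℕ → ℂ[X] := fun n => ∑ k ∈ Finset.range n, C (q.coeff k) * X ^ k
  have hlim : Tendsto (fun n => (⟨fun z => (P n).eval z, (P n).continuous⟩ : C(ℂ, ℂ)))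
      atTop (𝓝 f) := by
    rw [ContinuousMap.tendsto_iff_tendstoLocallyUniformly, ← tendstoLocallyUniformlyOn_univ]
    have h := hs.tendstoLocallyUniformlyOn'
    rw [Metric.eball_top] at h
    refine h.congr fun n z _ => ?_
    simp only [P, FormalMultilinearSeries.partialSum, ContinuousMap.coe_mk, eval_finsetSum,
      eval_mul, eval_C, eval_pow, eval_X, FormalMultilinearSeries.apply_eq_pow_smul_coeff,
      smul_eq_mul, sub_zero]
    exact Finset.sum_congr rfl fun k _ => mul_comm _ _
  obtain ⟨n, hn⟩ := (hlim.eventually (hU.mem_nhds hfU)).exists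
  exact ⟨P n, hn⟩

lemma continuous_polyApply (P : ℂ[X]) : Continuous (polyApply P) :=
  Continuous.subtype_mk
    ((ContinuousMap.continuous_postcomp ⟨fun z => P.eval z, P.continuous⟩).comp
      continuous_subtype_val) _

variable {T : Entire → Entire}

lemma continuous_of_apply_eq_deriv
    (hT : ∀ (f : Entire) (z : ℂ), (T f).1 z = deriv (⇑f.1) (z + 1)) : Continuous T := by
  rw [continuous_iff_continuousAt]
  intro f
  rw [ContinuousAt, tendsto_subtype_rng, ContinuousMap.tendsto_iff_tendstoLocallyUniformly]
  have h : Tendsto (fun g : Entire => g.1) (𝓝 f) (𝓝 f.1) := continuous_subtype_val.continuousAt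
  rw [ContinuousMap.tendsto_iff_tendstoLocallyUniformly, ← tendstoLocallyUniformlyOn_univ] at h
  have hd := h.deriv (Eventually.of_forall fun g => g.2.differentiableOn) isOpen_univ
  rw [tendstoLocallyUniformlyOn_univ] at hd
  have hc := hd.comp (fun z : ℂ => z + 1) (by fun_prop)
  convert hc using 1
  · ext g z
    exact hT g z
  · ext z
    exact hT f z

lemma iterate_apply_eq_sum
    (hT : ∀ (f : Entire) (z : ℂ), (T f).1 z = deriv (⇑f.1) (z + 1))
    {κ : Type*} (s : Finset κ) (a : κ → ℂ) (g : κ → Entire) (f : Entire)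
    (hf : ∀ z, f.1 z = ∑ i ∈ s, a i * (g i).1 z) (q : ℕ) (z : ℂ) :
    (T^[q] f).1 z = ∑ i ∈ s, a i * (T^[q] (g i)).1 z := by
  induction q generalizing z with
  | zero => exact hf z
  | succ q ih =>
    simp only [Function.iterate_succ_apply', hT]
    rw [show ⇑(T^[q] f).1 = fun z => ∑ i ∈ s, a i * (T^[q] (g i)).1 z from funext ih,
      deriv_fun_sum fun i _ => ((T^[q] (g i)).2 _).const_mul _]
    exact Finset.sum_congr rfl fun i _ => deriv_const_mul _ ((T^[q] (g i)).2 _)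

/-! ### Exponential sums -/

/-- The exponential sum `∑ i, c i * exp (ν i * z)`. -/
def expSum {ι : Type*} [Fintype ι] (ν c : ι → ℂ) : Entire :=
  ⟨⟨fun z => ∑ i, c i * Complex.exp (ν i * z), by fun_prop⟩,
    (by fun_prop : Differentiable ℂ fun z => ∑ i, c i * Complex.exp (ν i * z))⟩

/-- The symbol `μ * exp μ` of the operator `f ↦ f' (· + 1)`. -/
def symbol (μ : ℂ) : ℂ := μ * Complex.exp μ

section ExpSum

variable {ι : Type*} [Fintype ι] (ν c : ι → ℂ)

lemma expSum_apply (z : ℂ) : (expSum ν c).1 z = ∑ i, c i * Complex.exp (ν i * z) := rfl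

lemma continuous_expSum : Continuous (expSum ν) :=
  Continuous.subtype_mk (ContinuousMap.continuous_of_continuous_uncurry _
    (by dsimp [Function.uncurry_def]; fun_prop)) _

lemma expSum_pow (j : ℕ) :
    polyApply (X ^ j) (expSum ν c) =
      expSum (fun g : Fin j → ι => ∑ l, ν (g l)) (fun g => ∏ l, c (g l)) := by
  apply Subtype.ext
  ext z
  change ((X : ℂ[X]) ^ j).eval (∑ i, c i * Complex.exp (ν i * z)) = _
  rw [eval_pow, eval_X, Finset.sum_pow', expSum_apply, Fintype.piFinset_univ]
  refine Finset.sum_congr rfl fun g _ => ?_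
  rw [Finset.prod_mul_distrib, ← Complex.exp_sum, Finset.sum_mul]

lemma iterate_expSum
    (hT : ∀ (f : Entire) (z : ℂ), (T f).1 z = deriv (⇑f.1) (z + 1)) (q : ℕ) :
    T^[q] (expSum ν c) = expSum ν fun i => c i * symbol (ν i) ^ q := by
  induction q with
  | zero => simp
  | succ q ih =>
    rw [Function.iterate_succ_apply', ih]
    apply Subtype.ext
    ext z
    rw [hT]
    refine HasDerivAt.deriv ?_
    have h : ∀ i ∈ Finset.univ, HasDerivAt
        (fun w => c i * symbol (ν i) ^ q * Complex.exp (ν i * w))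
        (c i * symbol (ν i) ^ (q + 1) * Complex.exp (ν i * z)) (z + 1) := by
      intro i _
      have h1 : HasDerivAt (fun w : ℂ => ν i * w) (ν i) (z + 1) := by
        simpa using (hasDerivAt_id (z + 1)).const_mul (ν i)
      refine (h1.cexp.const_mul (c i * symbol (ν i) ^ q)).congr_deriv ?_
      rw [pow_succ, symbol, mul_add, Complex.exp_add, mul_one]
      ring
    exact HasDerivAt.fun_sum h

end ExpSum

/-- `z ↦ exp (iεz) * p ((exp (iεz) - 1) / (iε))`, with the quotient continued to `z` at `ε = 0`,
is a family of exponential sums that depends continuously on `ε` and equals `p` at `ε = 0`. -/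
lemma exists_expSum_mem {U : Set C(ℂ, ℂ)} (hU : IsOpen U) {f : C(ℂ, ℂ)}
    (hf : Differentiable ℂ f) (hfU : f ∈ U) {δ : ℝ} (hδ : 0 < δ) :
    ∃ (n : ℕ) (t : Fin n → ℝ) (c : Fin n → ℂ), Function.Injective t ∧
      (∀ i, 0 < t i ∧ t i < δ) ∧ (expSum (fun i => Complex.I * t i) c).1 ∈ U := by
  obtain ⟨p, hp⟩ := exists_polynomial_mem hU hf hfU
  let ψ : ℂ → ℂ := dslope Complex.exp 0
  have hψ : Continuous ψ := by
    rw [← continuousOn_univ]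
    exact (continuousOn_dslope univ_mem).2
      ⟨Complex.continuous_exp.continuousOn, Complex.differentiable_exp 0⟩
  have hψ0 : ψ 0 = 1 := by simp [ψ]
  have hψw : ∀ w, w ≠ 0 → ψ w = (Complex.exp w - 1) / w := by
    intro w hw
    simp [ψ, dslope_of_ne _ hw, slope_def_field]
  let F : ℝ → C(ℂ, ℂ) := fun ε =>
    ⟨fun z => Complex.exp (Complex.I * ε * z) * p.eval (z * ψ (Complex.I * ε * z)), by fun_prop⟩
  have hF : Continuous F := ContinuousMap.continuous_of_continuous_uncurry _ (by
    have : Continuous fun x : ℝ × ℂ => Complex.exp (Complex.I * x.1 * x.2) *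
      p.eval (x.2 * ψ (Complex.I * x.1 * x.2)) := by fun_prop
    exact this)
  have hF0 : F 0 ∈ U := by
    convert hp using 1
    ext z
    simp [F, hψ0]
  set n := p.natDegree + 1 with hn
  have hsmall : ∀ᶠ ε : ℝ in 𝓝[>] 0, F ε ∈ U ∧ 0 < ε ∧ ε * n < δ := by
    refine ((hF.tendsto 0).mono_left nhdsWithin_le_nhds |>.eventually (hU.mem_nhds hF0)).and
      (eventually_mem_nhdsWithin.and ?_)
    have : Tendsto (fun ε : ℝ => ε * n) (𝓝 0) (𝓝 0) :=
      (continuous_mul_const (n : ℝ)).tendsto' _ _ (by simp)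
    exact (this.mono_left nhdsWithin_le_nhds).eventually (gt_mem_nhds hδ)
  obtain ⟨ε, hεU, hε, hεn⟩ := hsmall.exists
  have hεC : Complex.I * (ε : ℂ) ≠ 0 := by simp [hε.ne']
  set R : ℂ[X] := p.comp (C (Complex.I * ε)⁻¹ * (X - 1)) with hR
  have hRdeg : R.natDegree < n := by
    rw [hn, Nat.lt_succ_iff, hR, natDegree_comp]
    have : (C (Complex.I * (ε : ℂ))⁻¹ * (X - 1) : ℂ[X]).natDegree ≤ 1 := by
      rw [← C_1]; compute_degree
    nlinarith
  refine ⟨n, fun i => ε * (i + 1), fun i => R.coeff i, ?_, ?_, ?_⟩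
  · intro i j hij
    have := mul_left_cancel₀ hε.ne' hij
    exact Fin.ext (by exact_mod_cast add_right_cancel this)
  · refine fun i => ⟨by positivity, lt_of_le_of_lt ?_ hεn⟩
    exact mul_le_mul_of_nonneg_left (by exact_mod_cast i.2) hε.le
  · convert hεU using 1
    ext z
    have hz : z * ψ (Complex.I * ε * z) =
        (Complex.I * ε)⁻¹ * (Complex.exp (Complex.I * ε * z) - 1) := by
      by_cases h : z = 0
      · simp [h]
      · rw [hψw _ (mul_ne_zero hεC h)]
        field_simp
    have hev : (F ε) z = Complex.exp (Complex.I * ε * z) *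
        R.eval (Complex.exp (Complex.I * ε * z)) := by
      simp only [F, ContinuousMap.coe_mk, hz, hR, eval_comp]
      simp
    rw [hev, eval_eq_sum_range' hRdeg, expSum_apply, Finset.mul_sum,
      ← Fin.sum_univ_eq_sum_range
        (fun i => Complex.exp (Complex.I * ε * z) * (R.coeff i * _ ^ i))]
    refine Finset.sum_congr rfl fun i _ => ?_
    rw [mul_left_comm, ← pow_succ', ← Complex.exp_nat_mul]
    push_cast
    congr 2
    ring

/-! ### The modulus of the symbol -/

lemma norm_symbol (μ : ℂ) : ‖symbol μ‖ = ‖μ‖ * Real.exp μ.re := by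
  rw [symbol, norm_mul, Complex.norm_exp]

lemma exists_pos_mul_exp_eq_one : ∃ ω : ℝ, 0 < ω ∧ ω * Real.exp ω = 1 := by
  have hc : ContinuousOn (fun x : ℝ => x * Real.exp x) (Icc 0 1) := by fun_prop
  obtain ⟨ω, hω, h⟩ := intermediate_value_Icc zero_le_one hc
    (show (1 : ℝ) ∈ Icc _ _ by
      simp only [zero_mul, one_mul, mem_Icc, zero_le_one, true_and]
      exact Real.one_le_exp zero_le_one)
  refine ⟨ω, lt_of_le_of_ne hω.1 ?_, h⟩
  rintro rfl
  simp at h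

variable {ω δ : ℝ} {m : ℕ}

lemma norm_symbol_sum_lt_one (hω : 0 < ω) (hωe : ω * Real.exp ω = 1) (hm : 0 < m)
    (hδ : m ^ 2 * δ < ω) {j : ℕ} (hjm : j ≤ m) {r : Fin j → ℂ}
    (hre : ∀ l, 0 ≤ (r l).re ∧ (r l).re ≤ ω / m) (him : ∀ l, |(r l).im| ≤ δ) (hδ0 : 0 ≤ δ)
    (h : j < m ∨ ∃ l, (r l).re = 0) : ‖symbol (∑ l, r l)‖ < 1 := by
  have hm' : (0 : ℝ) < m := by exact_mod_cast hm
  have hjm' : (j : ℝ) ≤ m := by exact_mod_cast hjm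
  have hx0 : 0 ≤ (∑ l, r l).re := by
    rw [Complex.re_sum]
    exact Finset.sum_nonneg fun l _ => (hre l).1
  have hx : (∑ l, r l).re ≤ (m - 1) * (ω / m) := by
    rw [Complex.re_sum]
    rcases h with h | ⟨l, hl⟩
    · calc ∑ l, (r l).re ≤ ∑ _l : Fin j, ω / m := Finset.sum_le_sum fun l _ => (hre l).2
        _ = j * (ω / m) := by simp
        _ ≤ (m - 1) * (ω / m) := by
          have : (j : ℝ) + 1 ≤ m := by exact_mod_cast h
          gcongr
          linarith
    · rw [← Finset.add_sum_erase _ _ (Finset.mem_univ l), hl, zero_add]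
      calc ∑ l ∈ Finset.univ.erase l, (r l).re
          ≤ ∑ _l ∈ Finset.univ.erase l, ω / m := Finset.sum_le_sum fun l _ => (hre l).2
        _ = ((j - 1 : ℕ) : ℝ) * (ω / m) := by simp
        _ ≤ (m - 1) * (ω / m) := by
          have : 1 ≤ j := l.pos
          gcongr
          push_cast [this]
          linarith
  have hy : |(∑ l, r l).im| ≤ m * δ := by
    rw [Complex.im_sum]
    calc |∑ l, (r l).im| ≤ ∑ l, |(r l).im| := Finset.abs_sum_le_sum_abs _ _
      _ ≤ ∑ _l : Fin j, δ := Finset.sum_le_sum fun l _ => him l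
      _ = j * δ := by simp
      _ ≤ m * δ := by gcongr
  have hle : (m - 1) * (ω / m) + m * δ < ω := by
    have h1 : (m - 1) * (ω / m) = ω - ω / m := by field_simp
    have h2 : m * δ < ω / m := by
      rw [lt_div_iff₀ hm']
      nlinarith
    linarith
  have hxω : (∑ l, r l).re ≤ ω := by nlinarith [mul_nonneg hm'.le hδ0]
  rw [norm_symbol]
  calc ‖∑ l, r l‖ * Real.exp (∑ l, r l).re
      ≤ (|(∑ l, r l).re| + |(∑ l, r l).im|) * Real.exp ω := by
        gcongr
        exact Complex.norm_le_abs_re_add_abs_im _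
    _ < ω * Real.exp ω := by
        have := Real.exp_pos ω
        rw [abs_of_nonneg hx0]
        gcongr
        linarith
    _ = 1 := hωe

lemma norm_symbol_add_I_mul (ω t : ℝ) :
    ‖symbol (ω + Complex.I * t)‖ = Real.sqrt (ω ^ 2 + t ^ 2) * Real.exp ω := by
  rw [norm_symbol, mul_comm Complex.I, Complex.norm_add_mul_I]
  simp

lemma one_lt_norm_symbol (hωe : ω * Real.exp ω = 1) {t : ℝ} (ht : 0 < t) :
    1 < ‖symbol (ω + Complex.I * t)‖ := by
  rw [norm_symbol_add_I_mul, ← hωe]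
  gcongr
  exact Real.lt_sqrt_of_sq_lt (by nlinarith)

lemma strictConvexOn_log_norm_symbol (hω : 0 < ω) :
    StrictConvexOn ℝ (Ioo 0 ω) fun t : ℝ => Real.log ‖symbol (ω + Complex.I * t)‖ := by
  have hpos : ∀ t : ℝ, 0 < ω ^ 2 + t ^ 2 := fun t => by positivity
  have heq : (fun t : ℝ => Real.log ‖symbol (ω + Complex.I * t)‖) =
      fun t => Real.log (ω ^ 2 + t ^ 2) / 2 + ω := by
    ext t
    rw [norm_symbol_add_I_mul, Real.log_mul (Real.sqrt_pos.2 (hpos t)).ne' (Real.exp_pos _).ne',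
      Real.log_exp, Real.log_sqrt (hpos t).le]
  have hd : ∀ t : ℝ, HasDerivAt (fun t : ℝ => Real.log (ω ^ 2 + t ^ 2) / 2 + ω)
      (t / (ω ^ 2 + t ^ 2)) t := by
    intro t
    have h1 : HasDerivAt (fun t : ℝ => ω ^ 2 + t ^ 2) (2 * t) t := by
      simpa using (hasDerivAt_pow 2 t).const_add (ω ^ 2)
    refine (((h1.log (hpos t).ne').div_const 2).add_const ω).congr_deriv ?_
    have := (hpos t).ne'
    field_simp
  rw [heq]
  refine StrictMonoOn.strictConvexOn_of_deriv (convex_Ioo 0 ω)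
    (fun t _ => (hd t).continuousAt.continuousWithinAt) ?_
  rw [interior_Ioo]
  intro s hs t ht hst
  rw [(hd s).deriv, (hd t).deriv, div_lt_div_iff₀ (hpos s) (hpos t)]
  have h1 : s * t < ω ^ 2 := by nlinarith [hs.1, hs.2, ht.1, ht.2]
  nlinarith [mul_pos (sub_pos.2 hst) (sub_pos.2 h1)]

lemma norm_symbol_average_pow_lt (hω : 0 < ω) (hm : 0 < m) {t : Fin m → ℝ}
    (ht : ∀ l, t l ∈ Ioo 0 ω) (hne : ∃ k l, t k ≠ t l) :
    ‖symbol (∑ l, (ω + Complex.I * t l) / m)‖ ^ m < ∏ l, ‖symbol (ω + Complex.I * t l)‖ := by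
  have hm' : (0 : ℝ) < m := by exact_mod_cast hm
  have hmC : (m : ℂ) ≠ 0 := by exact_mod_cast hm.ne'
  have hpos : ∀ s : ℝ, 0 < ‖symbol (ω + Complex.I * s)‖ := fun s => by
    rw [norm_symbol_add_I_mul]
    positivity
  obtain ⟨k, l, hkl⟩ := hne
  have hJ := (strictConvexOn_log_norm_symbol hω).map_sum_lt (t := Finset.univ)
    (w := fun _ : Fin m => (m : ℝ)⁻¹) (p := t) (fun _ _ => by positivity)
    (by simp [hm'.ne']) (fun l _ => ht l) ⟨k, Finset.mem_univ _, l, Finset.mem_univ _, hkl⟩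
  have hsum : ∑ l, (ω + Complex.I * t l) / (m : ℂ) =
      ω + Complex.I * ((∑ l, (m : ℝ)⁻¹ • t l : ℝ) : ℂ) := by
    simp only [add_div, Finset.sum_add_distrib, Finset.sum_const, Finset.card_univ,
      Fintype.card_fin, nsmul_eq_mul, smul_eq_mul]
    push_cast
    rw [mul_div_cancel₀ _ hmC, Finset.mul_sum]
    congr 1
    exact Finset.sum_congr rfl fun l _ => by ring
  rw [hsum, ← Real.log_lt_log_iff (pow_pos (hpos _) _) (Finset.prod_pos fun l _ => hpos _),
    Real.log_pow, Real.log_prod fun l _ => (hpos _).ne']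
  calc _ < m * ∑ l, (m : ℝ)⁻¹ • Real.log ‖symbol (ω + Complex.I * t l)‖ := by gcongr
    _ = _ := by
      simp only [smul_eq_mul]
      rw [← Finset.mul_sum, mul_inv_cancel_left₀ hm'.ne']

lemma norm_prod_mul_symbol_lt_one (hω : 0 < ω) (hωe : ω * Real.exp ω = 1) (hm : 0 < m)
    (hδ : m ^ 2 * δ < ω) (hδ0 : 0 ≤ δ) {a b : ℕ} {s : Fin a → ℝ} {t : Fin b → ℝ}
    (hs : ∀ i, 0 < s i ∧ s i < δ) (ht : ∀ i, 0 < t i ∧ t i < δ) (htinj : Function.Injective t)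
    {φ : Fin b → ℂ} (hφ : ∀ i, φ i ^ m * symbol (ω + Complex.I * t i) = 1)
    {j : ℕ} (hjm : j ≤ m) (g : Fin j → Fin a ⊕ Fin b) :
    ‖(∏ l, Sum.elim 1 φ (g l)) * symbol (∑ l, Sum.elim (fun i => Complex.I * (s i : ℂ))
        (fun i => (ω + Complex.I * t i) / m) (g l))‖ < 1 ∨
      j = m ∧ ∃ i, g = fun _ => Sum.inr i := by
  have hm' : (1 : ℝ) ≤ m := by exact_mod_cast hm
  have hδω : δ < ω := by nlinarith [one_le_pow₀ hm' (n := 2)]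
  have hφn : ∀ i, ‖φ i‖ ^ m * ‖symbol (ω + Complex.I * t i)‖ = 1 := fun i => by
    rw [← norm_pow, ← norm_mul, hφ, norm_one]
  have hφ1 : ∀ i, ‖φ i‖ ≤ 1 := fun i => by
    by_contra! h
    have h1 := one_lt_norm_symbol hωe (ht i).1
    nlinarith [hφn i, one_le_pow₀ h.le (n := m)]
  by_cases hcase : j < m ∨ ∃ l i, g l = Sum.inl i
  · left
    rw [norm_mul, norm_prod]
    refine lt_of_le_of_lt (mul_le_of_le_one_left (norm_nonneg _)
      (Finset.prod_le_one (fun _ _ => norm_nonneg _) fun l _ => ?_))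
      (norm_symbol_sum_lt_one hω hωe hm hδ hjm (fun l => ?_) (fun l => ?_) hδ0 ?_)
    · rcases g l with i | i
      · simp
      · exact hφ1 i
    · rcases g l with i | i
      · simp only [Sum.elim_inl, Complex.re_mul_ofReal, Complex.I_re, zero_mul, le_refl, true_and]
        positivity
      · simp [Complex.div_natCast_re]
        positivity
    · rcases g l with i | i
      · simpa [abs_of_pos (hs i).1] using (hs i).2.le
      · simp only [Sum.elim_inr, Complex.div_natCast_im, Complex.add_im, Complex.ofReal_im,
          Complex.im_mul_ofReal, Complex.I_im, one_mul, zero_add]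
        rw [abs_of_pos (div_pos (ht i).1 (by linarith))]
        exact (div_le_self (ht i).1.le hm').trans (ht i).2.le
    · refine hcase.imp_right ?_
      rintro ⟨l, i, hi⟩
      exact ⟨l, by simp [hi]⟩
  · push Not at hcase
    obtain ⟨hmj, hg⟩ := hcase
    obtain rfl : j = m := le_antisymm hjm hmj
    have hg' : ∀ l, ∃ i, g l = Sum.inr i := fun l => by
      rcases h : g l with i | i
      · exact absurd h (hg l i)
      · exact ⟨i, rfl⟩
    choose h hh using hg'
    by_cases hc : ∃ k l, h k ≠ h l
    · left
      obtain ⟨k, l, hkl⟩ := hc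
      have hlt := norm_symbol_average_pow_lt hω hm (t := fun l => t (h l))
        (fun l => ⟨(ht _).1, (ht _).2.trans hδω⟩) ⟨k, l, fun e => hkl (htinj e)⟩
      have hprod : 0 < ∏ l, ‖φ (h l)‖ ^ j := Finset.prod_pos fun l _ => by
        have := hφn (h l)
        by_contra! h0
        nlinarith [norm_nonneg (symbol (ω + Complex.I * t (h l)))]
      rw [← pow_lt_one_iff_of_nonneg (norm_nonneg _) hm.ne', norm_mul, norm_prod, mul_pow,
        ← Finset.prod_pow]
      simp only [hh, Sum.elim_inr]
      calc _ < (∏ l, ‖φ (h l)‖ ^ j) * ∏ l, ‖symbol (ω + Complex.I * t (h l))‖ := by gcongr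
        _ = 1 := by
          rw [← Finset.prod_mul_distrib]
          exact Finset.prod_eq_one fun l _ => hφn _
    · push Not at hc
      exact Or.inr ⟨rfl, h ⟨0, hm⟩, funext fun l => by rw [hh, hc l]⟩

/-! ### The hypercyclic algebra -/

lemma exists_iterate_mem
    (hT : ∀ (f : Entire) (z : ℂ), (T f).1 z = deriv (⇑f.1) (z + 1)) (hm : 0 < m)
    {U V W : Set Entire} (hU : IsOpen U) (hUne : U.Nonempty) (hV : IsOpen V) (hVne : V.Nonempty)
    (hW : IsOpen W) (hW0 : 0 ∈ W) :
    ∃ f ∈ U, ∃ q : ℕ, (∀ j < m, T^[q] (polyApply (X ^ j) f) ∈ W) ∧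
      T^[q] (polyApply (X ^ m) f) ∈ V := by
  obtain ⟨ω, hω, hωe⟩ := exists_pos_mul_exp_eq_one
  have hm' : (0 : ℝ) < m := by exact_mod_cast hm
  obtain ⟨δ, hδ0, hδ⟩ : ∃ δ : ℝ, 0 < δ ∧ m ^ 2 * δ < ω := by
    refine ⟨ω / (2 * m ^ 2), by positivity, ?_⟩
    field_simp
    linarith
  obtain ⟨U', hU', rfl⟩ := isOpen_induced_iff.1 hU
  obtain ⟨V', hV', rfl⟩ := isOpen_induced_iff.1 hV
  obtain ⟨f, hf⟩ := hUne
  obtain ⟨h, hh⟩ := hVne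
  obtain ⟨a, s, α, -, hs, hα⟩ := exists_expSum_mem hU' f.2 hf hδ0
  let E : C(ℂ, ℂ) := ⟨fun z => Complex.exp (ω * z), by fun_prop⟩
  have hV'' : IsOpen ((fun k : C(ℂ, ℂ) => E * k) ⁻¹' V') := hV'.preimage (by fun_prop)
  let k : C(ℂ, ℂ) := ⟨fun z => Complex.exp (-(ω * z)) * h.1 z, by fun_prop⟩
  have hk : Differentiable ℂ k := by
    have := h.2
    exact (by fun_prop : Differentiable ℂ fun z => Complex.exp (-(ω * z)) * h.1 z)
  have hkV : k ∈ (fun k : C(ℂ, ℂ) => E * k) ⁻¹' V' := by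
    have hEk : E * k = h.1 := by
      ext z
      simp [E, k, ← mul_assoc, ← Complex.exp_add]
    change E * k ∈ V'
    exact hEk ▸ hh
  obtain ⟨b, t, c, htinj, ht, hc⟩ := exists_expSum_mem hV'' hk hkV hδ0
  have hsym : ∀ i, symbol (ω + Complex.I * t i) ≠ 0 := fun i => by
    have := one_lt_norm_symbol hωe (ht i).1
    exact norm_pos_iff.1 (one_pos.trans this)
  choose φ hφ using fun i => IsAlgClosed.exists_pow_nat_eq (symbol (ω + Complex.I * t i))⁻¹ hm
  choose β hβ using fun i => IsAlgClosed.exists_pow_nat_eq (c i) hm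
  have hφ' : ∀ i, φ i ^ m * symbol (ω + Complex.I * t i) = 1 := fun i => by
    rw [hφ, inv_mul_cancel₀ (hsym i)]
  let ν : Fin a ⊕ Fin b → ℂ :=
    Sum.elim (fun i => Complex.I * (s i : ℂ)) fun i => (ω + Complex.I * t i) / m
  let φ' : Fin a ⊕ Fin b → ℂ := Sum.elim 1 φ
  let β' : Fin a ⊕ Fin b → ℂ := Sum.elim α β
  let F : ℕ → Entire := fun q => expSum ν fun i => β' i * φ' i ^ q
  have hφlt : ∀ i, ‖φ i‖ < 1 := fun i => by
    by_contra! h1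
    have h2 := one_lt_norm_symbol hωe (ht i).1
    have h3 : ‖φ i‖ ^ m * ‖symbol (ω + Complex.I * t i)‖ = 1 := by
      rw [← norm_pow, ← norm_mul, hφ', norm_one]
    nlinarith [one_le_pow₀ h1 (n := m)]
  have hFlim : Tendsto F atTop (𝓝 (expSum ν (Sum.elim α 0))) := by
    refine ((continuous_expSum ν).tendsto _).comp (tendsto_pi_nhds.2 ?_)
    rintro (i | i)
    · simp [β', φ']
    · simpa [β', φ'] using (tendsto_pow_atTop_nhds_zero_of_norm_lt_one (hφlt i)).const_mul (β i)
  have hFU : expSum ν (Sum.elim α 0) ∈ (Subtype.val ⁻¹' U' : Set Entire) := by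
    change (expSum ν (Sum.elim α 0)).1 ∈ U'
    convert hα using 1
    ext z
    simp [expSum_apply, ν]
  have hiter : ∀ j q, T^[q] (polyApply (X ^ j) (F q)) =
      expSum (fun g : Fin j → Fin a ⊕ Fin b => ∑ l, ν (g l)) fun g =>
        (∏ l, β' (g l)) * ((∏ l, φ' (g l)) * symbol (∑ l, ν (g l))) ^ q := by
    intro j q
    simp only [F]
    rw [expSum_pow, iterate_expSum _ _ hT]
    congr 1
    ext g
    rw [Finset.prod_mul_distrib, Finset.prod_pow, mul_pow, mul_assoc]
  have hdich := fun j (hj : j ≤ m) =>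
    norm_prod_mul_symbol_lt_one hω hωe hm hδ hδ0.le hs ht htinj hφ' hj
  have hlow : ∀ j < m, Tendsto (fun q => T^[q] (polyApply (X ^ j) (F q))) atTop (𝓝 0) := by
    intro j hj
    simp only [hiter]
    have h0 : (0 : Entire) =
        expSum (fun g : Fin j → Fin a ⊕ Fin b => ∑ l, ν (g l)) (fun _ => 0) := by
      apply Subtype.ext
      ext z
      rw [expSum_apply]
      simp only [zero_mul, Finset.sum_const_zero]
      rfl
    rw [h0]
    refine ((continuous_expSum _).tendsto _).comp (tendsto_pi_nhds.2 fun g => ?_)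
    have hlt := (hdich j hj.le g).resolve_right fun hr => hj.ne hr.1
    simpa using (tendsto_pow_atTop_nhds_zero_of_norm_lt_one hlt).const_mul (∏ l, β' (g l))
  let e : Fin b ↪ (Fin m → Fin a ⊕ Fin b) :=
    ⟨fun i _ => Sum.inr i, fun i i' hi => Sum.inr_injective (congrFun hi ⟨0, hm⟩)⟩
  have he : ∀ i l, e i l = Sum.inr i := fun _ _ => rfl
  classical
  let d : (Fin m → Fin a ⊕ Fin b) → ℂ := fun g =>
    if g ∈ Finset.univ.map e then ∏ l, β' (g l) else 0
  have hνe : ∀ i, ∑ l, ν (e i l) = ω + Complex.I * t i := fun i => by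
    have : (m : ℂ) ≠ 0 := by exact_mod_cast hm.ne'
    simp only [he, ν, Sum.elim_inr, Finset.sum_const, Finset.card_univ, Fintype.card_fin,
      nsmul_eq_mul]
    field_simp
  have htop : Tendsto (fun q => T^[q] (polyApply (X ^ m) (F q))) atTop
      (𝓝 (expSum (fun g : Fin m → Fin a ⊕ Fin b => ∑ l, ν (g l)) d)) := by
    simp only [hiter]
    refine ((continuous_expSum _).tendsto _).comp (tendsto_pi_nhds.2 fun g => ?_)
    by_cases hg : g ∈ Finset.univ.map e
    · obtain ⟨i, -, rfl⟩ := Finset.mem_map.1 hg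
      have h1 : (∏ l, φ' (e i l)) * symbol (∑ l, ν (e i l)) = 1 := by
        rw [hνe, ← hφ' i]
        simp [he, φ']
      simp only [h1, one_pow, mul_one, d, if_pos hg]
      exact tendsto_const_nhds
    · have hlt := (hdich m le_rfl g).resolve_right fun ⟨_, i, hi⟩ =>
        hg (Finset.mem_map.2 ⟨i, Finset.mem_univ _, hi.symm⟩)
      simp only [d, if_neg hg]
      simpa using (tendsto_pow_atTop_nhds_zero_of_norm_lt_one hlt).const_mul (∏ l, β' (g l))
  have hdV : expSum (fun g : Fin m → Fin a ⊕ Fin b => ∑ l, ν (g l)) d ∈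
      (Subtype.val ⁻¹' V' : Set Entire) := by
    change (expSum _ d).1 ∈ V'
    have hdc : (expSum (fun g : Fin m → Fin a ⊕ Fin b => ∑ l, ν (g l)) d).1 =
        E * (expSum (fun i => Complex.I * t i) c).1 := by
      ext z
      rw [expSum_apply, ContinuousMap.mul_apply, expSum_apply, Finset.mul_sum,
        ← Finset.sum_subset (Finset.subset_univ (Finset.univ.map e)) fun g _ hg => by
          simp only [d, if_neg hg, zero_mul], Finset.sum_map]
      refine Finset.sum_congr rfl fun i _ => ?_
      have hd : d (e i) = c i := by
        rw [← hβ i]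
        simp only [d, if_pos (Finset.mem_map_of_mem e (Finset.mem_univ i))]
        simp [he, β']
      rw [hd, hνe, mul_left_comm]
      simp only [E, ContinuousMap.coe_mk]
      rw [← Complex.exp_add, add_mul]
    exact hdc ▸ hc
  have hev : ∀ᶠ q in atTop, ∀ j ∈ Finset.range m, T^[q] (polyApply (X ^ j) (F q)) ∈ W :=
    (Finset.eventually_all _).2 fun j hj =>
      (hlow j (Finset.mem_range.1 hj)).eventually (hW.mem_nhds hW0)
  obtain ⟨q, hqU, hqW, hqV⟩ := ((hFlim.eventually (hU.mem_nhds hFU)).and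
    (hev.and (htop.eventually (hV.mem_nhds hdV)))).exists
  exact ⟨F q, hqU, q, fun j hj => hqW j (Finset.mem_range.2 hj), hqV⟩

/-- Functions for which, for every `m > 0`, some iterate sends the powers below the `m`-th
near `0` and the `m`-th power near any prescribed target. -/
lemma exists_forall_iterate_mem
    (hT : ∀ (f : Entire) (z : ℂ), (T f).1 z = deriv (⇑f.1) (z + 1)) :
    ∃ f : Entire, ∀ m, 0 < m → ∀ V W : Set Entire, IsOpen V → V.Nonempty → IsOpen W → 0 ∈ W →
      ∃ q : ℕ, (∀ j < m, T^[q] (polyApply (X ^ j) f) ∈ W) ∧ T^[q] (polyApply (X ^ m) f) ∈ V := by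
  have : SecondCountableTopology Entire :=
    Topology.IsEmbedding.subtypeVal.secondCountableTopology
  let B := TopologicalSpace.countableBasis Entire
  have hB : TopologicalSpace.IsTopologicalBasis B := TopologicalSpace.isBasis_countableBasis Entire
  have : Countable B := (TopologicalSpace.countable_countableBasis Entire).to_subtype
  let G : {x : ℕ × B × B // 0 < x.1 ∧ (0 : Entire) ∈ x.2.2.1} → Set Entire := fun x =>
    ⋃ q : ℕ, (⋂ j ∈ Finset.range x.1.1, {f | T^[q] (polyApply (X ^ j) f) ∈ x.1.2.2.1}) ∩
      {f | T^[q] (polyApply (X ^ x.1.1) f) ∈ x.1.2.1.1}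
  have hcont : ∀ q j, Continuous fun f => T^[q] (polyApply (X ^ j) f) := fun q j =>
    ((continuous_of_apply_eq_deriv hT).iterate q).comp (continuous_polyApply _)
  have hopen : ∀ x, IsOpen (G x) := fun x => isOpen_iUnion fun q =>
    (isOpen_biInter_finset fun j _ => (hB.isOpen x.1.2.2.2).preimage (hcont q j)).inter
      ((hB.isOpen x.1.2.1.2).preimage (hcont q _))
  have hdense : ∀ x, Dense (G x) := by
    rintro ⟨⟨m, V, W⟩, hm, hW0⟩
    rw [dense_iff_inter_open]
    intro U hU hUne
    obtain ⟨f, hfU, q, h1, h2⟩ := exists_iterate_mem hT hm hU hUne (hB.isOpen V.2)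
      (TopologicalSpace.nonempty_of_mem_countableBasis V.2) (hB.isOpen W.2) hW0
    refine ⟨f, hfU, mem_iUnion.2 ⟨q, ?_, h2⟩⟩
    simpa using h1
  have : Nonempty Entire := ⟨0⟩
  obtain ⟨f, hf⟩ := (dense_iInter_of_isOpen hopen hdense).nonempty
  refine ⟨f, fun m hm V W hV hVne hW hW0 => ?_⟩
  obtain ⟨v, hv⟩ := hVne
  obtain ⟨V₀, hV₀, -, hVV⟩ := hB.exists_subset_of_mem_open hv hV
  obtain ⟨W₀, hW₀, h0, hWW⟩ := hB.exists_subset_of_mem_open hW0 hW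
  have := mem_iInter.1 hf ⟨⟨m, ⟨V₀, hV₀⟩, ⟨W₀, hW₀⟩⟩, hm, h0⟩
  obtain ⟨q, h1, h2⟩ := mem_iUnion.1 this
  simp only [mem_iInter, Finset.mem_range] at h1
  exact ⟨q, fun j hj => hWW (h1 j hj), hVV h2⟩

lemma generatesHCAlgebra_of_forall_iterate_mem
    (hT : ∀ (f : Entire) (z : ℂ), (T f).1 z = deriv (⇑f.1) (z + 1)) {f : Entire}
    (hf : ∀ m, 0 < m → ∀ V W : Set Entire, IsOpen V → V.Nonempty → IsOpen W → 0 ∈ W →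
      ∃ q : ℕ, (∀ j < m, T^[q] (polyApply (X ^ j) f) ∈ W) ∧
        T^[q] (polyApply (X ^ m) f) ∈ V) :
    GeneratesHCAlgebra T f := by
  intro P hP0 hP
  have hPne : P ≠ 0 := by
    rintro rfl
    refine hP (Subtype.ext ?_)
    ext z
    exact eval_zero
  set m := P.natDegree with hm
  have hmpos : 0 < m := by
    rw [Nat.pos_iff_ne_zero]
    intro h0
    rw [hm] at h0
    rw [eq_C_of_natDegree_eq_zero h0, hP0, C_0] at hPne
    exact hPne rfl
  have hlead : P.coeff m ≠ 0 := leadingCoeff_ne_zero.2 hPne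
  rw [Hypercyclic, dense_iff_inter_open]
  intro O hO hOne
  obtain ⟨O', hO', rfl⟩ := isOpen_induced_iff.1 hO
  obtain ⟨h, hh⟩ := hOne
  let Ψ : (ℕ → Entire) → C(ℂ, ℂ) := fun x => ∑ j ∈ Finset.range (m + 1), P.coeff j • (x j).1
  have hΨ : Continuous Ψ := by fun_prop
  let k : Entire := ⟨(P.coeff m)⁻¹ • h.1, h.2.const_smul _⟩
  let x₀ : ℕ → Entire := fun j => if j = m then k else 0
  have hx₀ : x₀ ∈ Ψ ⁻¹' O' := by
    change Ψ x₀ ∈ O'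
    convert hh
    simp only [Ψ, x₀]
    rw [Finset.sum_eq_single m]
    · simp [k, hlead]
    · intro j _ hj
      rw [if_neg hj]
      exact smul_zero (A := C(ℂ, ℂ)) (P.coeff j)
    · simp
  obtain ⟨I, u, hu, huO⟩ := isOpen_pi_iff.1 (hO'.preimage hΨ) x₀ hx₀
  obtain ⟨q, hqW, hqV⟩ := hf m hmpos (if m ∈ I then u m else univ)
    (⋂ j ∈ I.filter (· ≠ m), u j)
    (by split_ifs with hI; exacts [(hu m hI).1, isOpen_univ])
    (by
      refine ⟨k, ?_⟩
      split_ifs with hI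
      · simpa [x₀] using (hu m hI).2
      · trivial)
    (isOpen_biInter_finset fun j hj => (hu j (Finset.mem_filter.1 hj).1).1)
    (by
      simp only [mem_iInter, Finset.mem_filter]
      intro j hj
      simpa [x₀, hj.2] using (hu j hj.1).2)
  let y : ℕ → Entire := fun j => if j ≤ m then T^[q] (polyApply (X ^ j) f) else 0
  have hy : y ∈ (I : Set ℕ).pi u := by
    intro j hj
    rcases lt_trichotomy j m with hjm | rfl | hjm
    · have := hqW j hjm
      simp only [mem_iInter, Finset.mem_filter] at this
      simpa [y, hjm.le] using this j ⟨hj, hjm.ne⟩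
    · simpa [y, Finset.mem_coe.1 hj] using hqV
    · simpa [y, x₀, hjm.not_ge, hjm.ne'] using (hu j hj).2
  refine ⟨_, ?_, q, rfl⟩
  change (T^[q] (polyApply P f)).1 ∈ O'
  suffices hΨy : (T^[q] (polyApply P f)).1 = Ψ y from hΨy ▸ huO hy
  ext z
  rw [iterate_apply_eq_sum hT (Finset.range (m + 1)) P.coeff (fun j => polyApply (X ^ j) f) _
    (fun z => ?_)]
  · simp only [Ψ, ContinuousMap.sum_apply, ContinuousMap.smul_apply, smul_eq_mul]
    refine Finset.sum_congr rfl fun j hj => ?_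
    simp only [y, if_pos (Nat.lt_succ_iff.1 (Finset.mem_range.1 hj))]
  · change P.eval (f.1 z) = ∑ j ∈ Finset.range (m + 1), P.coeff j * (X ^ j : ℂ[X]).eval (f.1 z)
    simp only [eval_pow, eval_X]
    exact eval_eq_sum_range _

end Entire

/-- The operator `De^D = D∘τ₁`, given by `(Tf)(z) = f′(z + 1)`, supports a
hypercyclic algebra on `H(ℂ)`. -/
theorem stmt8 (T : Entire → Entire)
    (hT : ∀ (f : Entire) (z : ℂ), (T f).1 z = deriv (⇑f.1) (z + 1)) :
    ∃ f : Entire, f ≠ 0 ∧ GeneratesHCAlgebra T f := by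
  obtain ⟨f, hf⟩ := Entire.exists_forall_iterate_mem hT
  refine ⟨f, ?_, Entire.generatesHCAlgebra_of_forall_iterate_mem hT hf⟩
  rintro rfl
  obtain ⟨q, -, hq⟩ := hf 1 one_pos {g | g.1 0 ≠ 0} univ
    (isOpen_ne.preimage ((continuous_eval_const (0 : ℂ)).comp continuous_subtype_val))
    ⟨⟨1, differentiable_const 1⟩, one_ne_zero⟩ isOpen_univ trivial
  refine hq ?_
  rw [Entire.iterate_apply_eq_sum hT (∅ : Finset ℕ) 0 (fun _ => 0) _ fun z => ?_]
  · simp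
  · change ((X : ℂ[X]) ^ 1).eval 0 = _
    simp
end
end
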